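/- arXiv:1812.06022 — 13 statements merged into one kernel-verified Lean document; each statement's English description precedes it below -/
import Mathlib

section
/- Let X be a two-dimensional real normed space that is strictly convex, whose norm is Fréchet differentiable at every nonzero point, and whose norm is not induced by an inner product (the parallelogram law fails). Then K₄ is rigid in X: there exists a placement p : {1,2,3,4} → X, with p_i − p_j ≠ 0 for all i ≠ j, such that every u : {1,2,3,4} → X satisfying D(p_i − p_j)(u_i − u_j) = 0 for all i ≠ j is a constant map. -/
section NormDerivative

variable {X : Type*} [NormedAddCommGroup X] [NormedSpace ℝ X]

theorem abs_fderiv_norm_apply_le (x y : X) :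
    |fderiv ℝ (fun x : X => ‖x‖) x y| ≤ ‖y‖ := by
  have h := (fderiv ℝ (fun x : X => ‖x‖) x).le_of_opNorm_le
    (norm_fderiv_le_of_lipschitz ℝ lipschitzWith_one_norm) y
  simpa using h

theorem fderiv_norm_eq_of_le {x : X} (hx : DifferentiableAt ℝ (fun x : X => ‖x‖) x)
    (φ : X →L[ℝ] ℝ) (hle : ∀ z, φ z ≤ ‖z‖) (heq : φ x = ‖x‖) :
    fderiv ℝ (fun x : X => ‖x‖) x = φ := by
  have hmin : IsLocalMin (fun z : X => ‖z‖ - φ z) x :=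
    Filter.Eventually.of_forall fun z => by
      have := hle z
      simp only [heq]
      linarith
  have h := (hx.hasFDerivAt.sub φ.hasFDerivAt).fderiv
  exact sub_eq_zero.1 (h ▸ hmin.fderiv_eq_zero)

theorem exists_norm_conjugate (hdim : Module.finrank ℝ X = 2)
    (hsm : ∀ z : X, z ≠ 0 → DifferentiableAt ℝ (fun x : X => ‖x‖) z) :
    ∃ e f : X, ‖e‖ = 1 ∧ ‖f‖ = 1 ∧ fderiv ℝ (fun x : X => ‖x‖) e f = 0 ∧
      fderiv ℝ (fun x : X => ‖x‖) f e = 0 := by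
  have : FiniteDimensional ℝ X := Module.finite_of_finrank_pos (by omega)
  have : ProperSpace X := FiniteDimensional.proper ℝ X
  let b := Module.finBasisOfFinrankEq ℝ X hdim
  let c₀ : X →L[ℝ] ℝ := (b.coord 0).toContinuousLinearMap
  let c₁ : X →L[ℝ] ℝ := (b.coord 1).toContinuousLinearMap
  let B : X × X → ℝ := fun q => c₀ q.1 * c₁ q.2 - c₁ q.1 * c₀ q.2
  have hB : Continuous B := by fun_prop
  have hb (i) : b i ≠ 0 := b.ne_zero i
  have hunit {z : X} (hz : z ≠ 0) : ‖‖z‖⁻¹ • z‖ = 1 := by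
    rw [norm_smul, norm_inv, norm_norm, inv_mul_cancel₀ (norm_ne_zero_iff.2 hz)]
  have hmem : (‖b 0‖⁻¹ • b 0, ‖b 1‖⁻¹ • b 1) ∈
      Metric.sphere (0 : X) 1 ×ˢ Metric.sphere (0 : X) 1 := by
    simp [hunit (hb _)]
  obtain ⟨⟨e, f⟩, hef, hmax⟩ := ((isCompact_sphere (0 : X) 1).prod
    (isCompact_sphere (0 : X) 1)).exists_isMaxOn ⟨_, hmem⟩ hB.continuousOn
  obtain ⟨he, hf⟩ : ‖e‖ = 1 ∧ ‖f‖ = 1 := by simpa using hef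
  have hM : 0 < B (e, f) := by
    refine lt_of_lt_of_le ?_ (hmax hmem)
    have h0 := norm_pos_iff.2 (hb 0)
    have h1 := norm_pos_iff.2 (hb 1)
    simp only [B, c₀, c₁, LinearMap.coe_toContinuousLinearMap', map_smul, Module.Basis.coord_apply,
      Module.Basis.repr_self]
    simp
    positivity
  have hmax' {z w : X} (hz : ‖z‖ = 1) (hw : ‖w‖ = 1) : B (z, w) ≤ B (e, f) :=
    hmax (show (z, w) ∈ _ by simp [hz, hw])
  have hscale (ψ : X →L[ℝ] ℝ) (hψ : ∀ z, ‖z‖ = 1 → ψ z ≤ B (e, f)) (z : X) :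
      ((B (e, f))⁻¹ • ψ) z ≤ ‖z‖ := by
    rcases eq_or_ne z 0 with rfl | hz
    · simp
    have h := hψ _ (hunit hz)
    rw [map_smul, smul_eq_mul, inv_mul_le_iff₀ (norm_pos_iff.2 hz)] at h
    simp only [FunLike.coe_smul, Pi.smul_apply, smul_eq_mul]
    rw [inv_mul_le_iff₀ hM]
    linarith
  refine ⟨e, f, he, hf, ?_, ?_⟩
  · rw [fderiv_norm_eq_of_le (hsm e (norm_ne_zero_iff.1 (by simp [he])))
      ((B (e, f))⁻¹ • (c₁ f • c₀ - c₀ f • c₁)) (hscale _ fun z hz => ?_) ?_]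
    · simp [mul_comm]
    · have h : (c₁ f • c₀ - c₀ f • c₁) e = B (e, f) := by simp [B]; ring
      rw [FunLike.coe_smul, Pi.smul_apply, h, he, smul_eq_mul, inv_mul_cancel₀ hM.ne']
    · refine le_trans (le_of_eq ?_) (hmax' hz hf)
      simp [B]; ring
  · rw [fderiv_norm_eq_of_le (hsm f (norm_ne_zero_iff.1 (by simp [hf])))
      ((B (e, f))⁻¹ • (c₀ e • c₁ - c₁ e • c₀)) (hscale _ fun z hz => ?_) ?_]
    · simp [mul_comm]
    · have h : (c₀ e • c₁ - c₁ e • c₀) f = B (e, f) := by simp [B]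
      rw [FunLike.coe_smul, Pi.smul_apply, h, hf, smul_eq_mul, inv_mul_cancel₀ hM.ne']
    · refine le_trans (le_of_eq ?_) (hmax' he hz)
      simp [B]

theorem eq_of_fderiv_norm_apply_eq_one
    (hsc : ∀ x y : X, x ≠ y → ‖x‖ = 1 → ‖y‖ = 1 →
      ∀ t : ℝ, 0 < t → t < 1 → ‖t • x + (1 - t) • y‖ < 1)
    (hsm : ∀ z : X, z ≠ 0 → DifferentiableAt ℝ (fun x : X => ‖x‖) z)
    {x y : X} (hx : ‖x‖ = 1) (hy : ‖y‖ = 1)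
    (h : fderiv ℝ (fun x : X => ‖x‖) x y = 1) : x = y := by
  by_contra hne
  have hlt := hsc x y hne hx hy (1 / 2) (by norm_num) (by norm_num)
  have hself := (hsm x (norm_ne_zero_iff.1 (by simp [hx]))).fderiv_norm_self
  have hle := (abs_le.1 (abs_fderiv_norm_apply_le x ((1 / 2 : ℝ) • x + (1 - 1 / 2 : ℝ) • y))).2
  rw [map_add, map_smul, map_smul, hself, h, hx] at hle
  norm_num at hle hlt
  linarith

theorem exists_eq_smul_of_fderiv_norm_eq_smul
    (hsc : ∀ x y : X, x ≠ y → ‖x‖ = 1 → ‖y‖ = 1 →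
      ∀ t : ℝ, 0 < t → t < 1 → ‖t • x + (1 - t) • y‖ < 1)
    (hsm : ∀ z : X, z ≠ 0 → DifferentiableAt ℝ (fun x : X => ‖x‖) z)
    {x y : X} (hx : x ≠ 0) (hy : y ≠ 0) {c : ℝ}
    (h : fderiv ℝ (fun x : X => ‖x‖) x = c • fderiv ℝ (fun x : X => ‖x‖) y) :
    ∃ r : ℝ, x = r • y := by
  have hxp := norm_pos_iff.2 hx
  have hyp := norm_pos_iff.2 hy
  have hxx := (hsm x hx).fderiv_norm_self
  have hyy := (hsm y hy).fderiv_norm_self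
  have hxy := abs_fderiv_norm_apply_le x y
  have hyx := abs_fderiv_norm_apply_le y x
  rw [h] at hxx hxy
  simp only [FunLike.coe_smul, Pi.smul_apply, smul_eq_mul] at hxx hxy
  rw [hyy, abs_mul, abs_norm] at hxy
  have hc : |c| ≤ 1 := by nlinarith
  have habs : |fderiv ℝ (fun x : X => ‖x‖) y x| = ‖x‖ := by
    refine le_antisymm hyx ?_
    calc ‖x‖ = |c| * |fderiv ℝ (fun x : X => ‖x‖) y x| := by rw [← abs_mul, hxx, abs_norm]
      _ ≤ _ := mul_le_of_le_one_left (abs_nonneg _) hc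
  have hunit (z : X) (hz : z ≠ 0) : ‖‖z‖⁻¹ • z‖ = 1 := by
    rw [norm_smul, norm_inv, norm_norm, inv_mul_cancel₀ (norm_ne_zero_iff.2 hz)]
  have key (z : X) (hz : z ≠ 0) (hyz : fderiv ℝ (fun x : X => ‖x‖) y z = ‖z‖) :
      ∃ r : ℝ, z = r • y := by
    have := eq_of_fderiv_norm_apply_eq_one hsc hsm (hunit y hy) (hunit z hz) (by
      rw [fderiv_norm_smul_pos (inv_pos.2 hyp), map_smul, hyz, smul_eq_mul,
        inv_mul_cancel₀ (norm_ne_zero_iff.2 hz)])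
    refine ⟨‖z‖ * ‖y‖⁻¹, ?_⟩
    rw [mul_smul, this, smul_inv_smul₀ (norm_ne_zero_iff.2 hz)]
  rcases eq_or_eq_neg_of_abs_eq habs with h1 | h1
  · exact key x hx h1
  · obtain ⟨r, hr⟩ := key (-x) (neg_ne_zero.2 hx) (by rw [map_neg, h1, neg_neg, norm_neg])
    exact ⟨-r, by rw [neg_smul, ← hr, neg_neg]⟩

theorem parallelogram_rigid {x y : X} (hx : x ≠ 0) (hy : y ≠ 0) (hadd : x + y ≠ 0)
    (hsub : x - y ≠ 0)
    (hinj : ∀ v, fderiv ℝ (fun x : X => ‖x‖) x v = 0 →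
      fderiv ℝ (fun x : X => ‖x‖) y v = 0 → v = 0)
    (hdiag : ∀ v w, fderiv ℝ (fun x : X => ‖x‖) x v = 0 →
      fderiv ℝ (fun x : X => ‖x‖) y w = 0 →
      fderiv ℝ (fun x : X => ‖x‖) (x + y) (v + w) = 0 →
      fderiv ℝ (fun x : X => ‖x‖) (x - y) (v - w) = 0 → v = 0 ∧ w = 0) :
    ∃ p : Fin 4 → X,
      (∀ i j : Fin 4, i ≠ j → p i - p j ≠ 0) ∧
      ∀ u : Fin 4 → X,
        (∀ i j : Fin 4, i ≠ j →
          fderiv ℝ (fun x : X => ‖x‖) (p i - p j) (u i - u j) = 0) →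
        ∃ c : X, ∀ i, u i = c := by
  refine ⟨![0, x, y, x + y], ?_, fun u hu => ⟨u 0, ?_⟩⟩
  · have hne : ∀ i j : Fin 4, i < j →
        (![0, x, y, x + y] : Fin 4 → X) j - (![0, x, y, x + y] : Fin 4 → X) i ≠ 0 := by
      intro i j hij
      have hyx : y - x ≠ 0 := fun h => hsub (by rw [← neg_sub, h, neg_zero])
      fin_cases i <;> fin_cases j <;> first
        | exact absurd hij (by decide)
        | simpa using hx
        | simpa using hy
        | simpa using hadd
        | simpa using hyx
    intro i j hij
    rcases lt_or_gt_of_ne hij with h | h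
    · rw [← neg_sub]
      exact neg_ne_zero.2 (hne i j h)
    · exact hne j i h
  · have h10 : fderiv ℝ (fun x : X => ‖x‖) x (u 1 - u 0) = 0 := by simpa using hu 1 0 (by decide)
    have h20 : fderiv ℝ (fun x : X => ‖x‖) y (u 2 - u 0) = 0 := by simpa using hu 2 0 (by decide)
    have h30 : fderiv ℝ (fun x : X => ‖x‖) (x + y) (u 3 - u 0) = 0 := by simpa using hu 3 0 (by decide)
    have h12 : fderiv ℝ (fun x : X => ‖x‖) (x - y) (u 1 - u 2) = 0 := by simpa using hu 1 2 (by decide)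
    have h31 : fderiv ℝ (fun x : X => ‖x‖) y (u 3 - u 1) = 0 := by simpa using hu 3 1 (by decide)
    have h32 : fderiv ℝ (fun x : X => ‖x‖) x (u 3 - u 2) = 0 := by simpa using hu 3 2 (by decide)
    have hpar := hinj ((u 3 - u 2) - (u 1 - u 0)) (by rw [map_sub, h32, h10, sub_zero]) (by
      rw [show (u 3 - u 2) - (u 1 - u 0) = (u 3 - u 1) - (u 2 - u 0) by abel, map_sub, h31, h20,
        sub_zero])
    have h3 : u 3 - u 0 = (u 1 - u 0) + (u 2 - u 0) := by
      rw [← sub_eq_zero, ← hpar]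
      abel
    obtain ⟨hv, hw⟩ := hdiag (u 1 - u 0) (u 2 - u 0) h10 h20 (h3 ▸ h30) (by
      rwa [show u 1 - u 0 - (u 2 - u 0) = u 1 - u 2 by abel])
    rw [hv, hw, add_zero] at h3
    intro i
    fin_cases i
    · rfl
    · exact sub_eq_zero.1 hv
    · exact sub_eq_zero.1 hw
    · exact sub_eq_zero.1 h3

theorem exists_eq_mul_of_midpoint {F : ℝ → ℝ} (hF : Measurable F) (h0 : F 0 = 0)
    (hmid : ∀ s t, s ≠ t → F s + F t = 2 * F ((s + t) / 2)) : ∃ k : ℝ, ∀ t, F t = k * t := by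
  have hmid' (s t) : F s + F t = 2 * F ((s + t) / 2) := by
    rcases eq_or_ne s t with rfl | h
    · rw [add_self_div_two, two_mul]
    · exact hmid s t h
  let φ : ℝ →+ ℝ := ⟨⟨F, h0⟩, fun s t => by
    have h1 := hmid' s t
    have h2 := hmid' (s + t) 0
    rw [add_zero] at h2
    linarith⟩
  have hφ : Continuous φ := MeasureTheory.Measure.AddMonoidHom.continuous_of_measurable φ hF
  refine ⟨F 1, fun t => ?_⟩
  have h := map_real_smul φ hφ t 1
  simp only [smul_eq_mul, mul_one] at h
  rw [mul_comm]
  exact h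

theorem sq_eq_of_mul_deriv_eq {h h' : ℝ → ℝ} {k : ℝ} (hd : ∀ t, HasDerivAt h (h' t) t)
    (hpos : ∀ t, 0 < h t) (hne : k ≠ 0) (hode : ∀ t, h' t * (1 + k * t ^ 2) = k * t * h t) (t : ℝ) :
    h t ^ 2 = h 0 ^ 2 * (1 + k * t ^ 2) := by
  have hk : 0 < k := by
    by_contra! hk
    have hk' : k < 0 := lt_of_le_of_ne hk hne
    have hinv : 0 < -k⁻¹ := neg_pos.2 (inv_lt_zero.2 hk')
    have := hode √(-k⁻¹)
    rw [Real.sq_sqrt hinv.le, mul_neg, mul_inv_cancel₀ hne, add_neg_cancel, mul_zero] at this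
    exact mul_ne_zero (mul_ne_zero hne (Real.sqrt_pos.2 hinv).ne') (hpos _).ne' this.symm
  have hq (t : ℝ) : 0 < 1 + k * t ^ 2 := by positivity
  have hder (t : ℝ) : HasDerivAt (fun t => h t ^ 2 / (1 + k * t ^ 2)) 0 t := by
    have h2 : HasDerivAt (fun t : ℝ => 1 + k * t ^ 2) (k * (2 * t)) t := by
      simpa using ((hasDerivAt_pow 2 t).const_mul k).const_add 1
    refine (((hd t).pow 2).div h2 (hq t).ne').congr_deriv ?_
    rw [div_eq_zero_iff]
    left
    simp only [Pi.pow_apply]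
    norm_num
    linear_combination 2 * h t * hode t
  have hconst := is_const_of_deriv_eq_zero (fun t => (hder t).differentiableAt)
    (fun t => (hder t).deriv) t 0
  have := (hq t).ne'
  field_simp at hconst
  rw [mul_comm (h 0 ^ 2)]
  simpa using hconst

theorem exists_eq_smul_add_smul (hdim : Module.finrank ℝ X = 2) {e f : X} (he : e ≠ 0)
    (hf : ∀ r : ℝ, f ≠ r • e) (z : X) : ∃ a b : ℝ, z = a • e + b • f := by
  have hli : LinearIndependent ℝ ![e, f] :=
    (LinearIndependent.pair_iff' he).2 fun r h => hf r h.symm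
  have htop := hli.span_eq_top_of_card_eq_finrank (by simp [hdim])
  have hz : z ∈ Submodule.span ℝ {e, f} := by
    rw [← Matrix.range_cons_cons_empty e f ![], htop]
    trivial
  obtain ⟨a, b, h⟩ := Submodule.mem_span_pair.1 hz
  exact ⟨a, b, h.symm⟩

theorem parallelogram_law_of_norm_add_smul {e f : X} (hspan : ∀ z : X, ∃ a b : ℝ, z = a • e + b • f)
    {k : ℝ} (h : ∀ t : ℝ, ‖e + t • f‖ ^ 2 = 1 + k * t ^ 2) (x y : X) :
    ‖x + y‖ ^ 2 + ‖x - y‖ ^ 2 = 2 * ‖x‖ ^ 2 + 2 * ‖y‖ ^ 2 := by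
  have hne (b : ℝ) : Set.EqOn (fun a : ℝ => ‖a • e + b • f‖ ^ 2) (fun a => a ^ 2 + k * b ^ 2)
      {0}ᶜ := by
    intro a ha
    have ha : a ≠ 0 := ha
    have hfac : a • e + b • f = a • (e + (b / a) • f) := by
      rw [smul_add, smul_smul, mul_div_cancel₀ _ ha]
    simp only [hfac, norm_smul, mul_pow, h, Real.norm_eq_abs, sq_abs]
    field_simp
  have hsq (a b : ℝ) : ‖a • e + b • f‖ ^ 2 = a ^ 2 + k * b ^ 2 :=
    congrFun (Continuous.ext_on (dense_compl_singleton (0 : ℝ)) (by fun_prop) (by fun_prop)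
      (hne b)) a
  obtain ⟨a, b, rfl⟩ := hspan x
  obtain ⟨c, d, rfl⟩ := hspan y
  rw [show a • e + b • f + (c • e + d • f) = (a + c) • e + (b + d) • f by module,
    show a • e + b • f - (c • e + d • f) = (a - c) • e + (b - d) • f by module]
  simp only [hsq]
  ring

end NormDerivative


/-- `K₄` is rigid in every strictly convex, smooth, non-Euclidean
normed plane. -/
theorem K4_rigid_of_strictlyConvex_smooth_nonEuclidean
    (X : Type*) [NormedAddCommGroup X] [NormedSpace ℝ X]
    (hdim : Module.finrank ℝ X = 2)
    (hsc : ∀ x y : X, x ≠ y → ‖x‖ = 1 → ‖y‖ = 1 →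
      ∀ t : ℝ, 0 < t → t < 1 → ‖t • x + (1 - t) • y‖ < 1)
    (hsm : ∀ z : X, z ≠ 0 → DifferentiableAt ℝ (fun x : X => ‖x‖) z)
    (hnE : ∃ x y : X, ‖x + y‖ ^ 2 + ‖x - y‖ ^ 2 ≠ 2 * ‖x‖ ^ 2 + 2 * ‖y‖ ^ 2) :
    ∃ p : Fin 4 → X,
      (∀ i j : Fin 4, i ≠ j → p i - p j ≠ 0) ∧
      ∀ u : Fin 4 → X,
        (∀ i j : Fin 4, i ≠ j →
          fderiv ℝ (fun x : X => ‖x‖) (p i - p j) (u i - u j) = 0) →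
        ∃ c : X, ∀ i, u i = c := by
  have hne0 {z : X} (hz : ‖z‖ = 1) : z ≠ 0 := norm_ne_zero_iff.1 (by simp [hz])
  obtain ⟨e, f, he, hf, hef, hfe⟩ := exists_norm_conjugate hdim hsm
  have hee : fderiv ℝ (fun x : X => ‖x‖) e e = 1 := by
    rw [(hsm e (hne0 he)).fderiv_norm_self, he]
  have hff : fderiv ℝ (fun x : X => ‖x‖) f f = 1 := by
    rw [(hsm f (hne0 hf)).fderiv_norm_self, hf]
  have hspan := exists_eq_smul_add_smul hdim (hne0 he) (f := f) fun r hr => by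
    have := congrArg (fderiv ℝ (fun x : X => ‖x‖) f) hr
    rw [map_smul, hff, hfe, smul_zero] at this
    exact one_ne_zero this
  have hline (t : ℝ) : e + t • f ≠ 0 := fun h => by
    have := congrArg (fderiv ℝ (fun x : X => ‖x‖) e) h
    simp [hee, hef] at this
  let h : ℝ → ℝ := fun t => ‖e + t • f‖
  have hd (t : ℝ) : HasDerivAt h (fderiv ℝ (fun x : X => ‖x‖) (e + t • f) f) t := by
    have hl : HasDerivAt (fun t : ℝ => e + t • f) f t := by
      simpa using ((hasDerivAt_id t).smul_const f).const_add e
    exact (hsm _ (hline t)).hasFDerivAt.comp_hasDerivAt t hl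
  have hA (t : ℝ) : fderiv ℝ (fun x : X => ‖x‖) (e + t • f) e = h t - t * deriv h t := by
    have := (hsm _ (hline t)).fderiv_norm_self
    rw [map_add, map_smul, ← (hd t).deriv, smul_eq_mul] at this
    exact eq_sub_of_add_eq this
  have hA0 (t : ℝ) : h t - t * deriv h t ≠ 0 := by
    intro h0
    have hprop : fderiv ℝ (fun x : X => ‖x‖) (e + t • f) =
        deriv h t • fderiv ℝ (fun x : X => ‖x‖) f := by
      ext z
      obtain ⟨a, b, rfl⟩ := hspan z
      simp [hA, h0, ← (hd t).deriv, hff, hfe, mul_comm]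
    obtain ⟨r, hr⟩ := exists_eq_smul_of_fderiv_norm_eq_smul hsc hsm (hline t) (hne0 hf) hprop
    have := congrArg (fderiv ℝ (fun x : X => ‖x‖) e) hr
    simp [hee, hef] at this
  let F : ℝ → ℝ := fun t => deriv h t / (h t - t * deriv h t)
  have hF (t a b : ℝ) : fderiv ℝ (fun x : X => ‖x‖) (e + t • f) (a • e + b • f) =
      (h t - t * deriv h t) * (a + F t * b) := by
    have h0 := hA0 t
    rw [map_add, map_smul, map_smul, hA, ← (hd t).deriv]
    simp only [F, smul_eq_mul]
    field_simp
  have hF0 (t a b : ℝ) (hz : fderiv ℝ (fun x : X => ‖x‖) (e + t • f) (a • e + b • f) = 0) :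
      a + F t * b = 0 :=
    (mul_eq_zero.1 ((hF t a b).symm.trans hz)).resolve_left (hA0 t)
  have hFinj : Function.Injective F := by
    intro s t hst
    have hprop : fderiv ℝ (fun x : X => ‖x‖) (e + s • f) =
        ((h s - s * deriv h s) / (h t - t * deriv h t)) •
          fderiv ℝ (fun x : X => ‖x‖) (e + t • f) := by
      ext z
      obtain ⟨a, b, rfl⟩ := hspan z
      rw [FunLike.coe_smul, Pi.smul_apply, hF, hF, hst, smul_eq_mul, ← mul_assoc,
        div_mul_cancel₀ _ (hA0 t)]
    obtain ⟨r, hr⟩ := exists_eq_smul_of_fderiv_norm_eq_smul hsc hsm (hline s) (hline t) hprop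
    have h1 := congrArg (fderiv ℝ (fun x : X => ‖x‖) e) hr
    have h2 := congrArg (fderiv ℝ (fun x : X => ‖x‖) f) hr
    simp [hee, hef] at h1
    simpa [hff, hfe, ← h1] using h2
  by_contra hcon
  have hmid (s t : ℝ) (hst : s ≠ t) : F s + F t = 2 * F ((s + t) / 2) := by
    by_contra hmid
    have hadd : e + s • f + (e + t • f) = (2 : ℝ) • (e + ((s + t) / 2) • f) := by module
    have hsub : e + s • f - (e + t • f) = (s - t) • f := by module
    have hst' := sub_ne_zero.2 hst
    have hFst : F s - F t ≠ 0 := sub_ne_zero.2 (hFinj.ne hst)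
    refine hcon (parallelogram_rigid (hline s) (hline t)
      (hadd ▸ smul_ne_zero two_ne_zero (hline _)) (hsub ▸ smul_ne_zero hst' (hne0 hf))
      (fun v hv hv' => ?_) fun v w hv hw hvw hvw' => ?_)
    · obtain ⟨a, b, rfl⟩ := hspan v
      have h1 := hF0 _ _ _ hv
      have h2 := hF0 _ _ _ hv'
      have hb : b = 0 :=
        (mul_eq_zero.1 (show (F s - F t) * b = 0 by linear_combination h1 - h2)).resolve_left hFst
      subst hb
      have ha : a = 0 := by simpa using h1
      simp [ha]
    · obtain ⟨a, b, rfl⟩ := hspan v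
      obtain ⟨c, d, rfl⟩ := hspan w
      rw [hadd, fderiv_norm_smul_pos two_pos,
        show a • e + b • f + (c • e + d • f) = (a + c) • e + (b + d) • f by module] at hvw
      have h1 := hF0 _ _ _ hv
      have h2 := hF0 _ _ _ hw
      have h3 := hF0 _ _ _ hvw
      have hbd : b = d := by
        rw [hsub, fderiv_norm_smul] at hvw'
        have hsign : ((SignType.sign (s - t) : SignType) : ℝ) ≠ 0 := by
          rcases lt_or_gt_of_ne hst' with hlt | hgt
          · simp [sign_neg hlt]
          · simp [sign_pos hgt]
        simpa [hff, hfe, hsign, sub_eq_zero] using hvw'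
      subst hbd
      have hb : b = 0 := (mul_eq_zero.1 (show (F s + F t - 2 * F ((s + t) / 2)) * b = 0 by
        linear_combination h1 + h2 - h3)).resolve_left (sub_ne_zero.2 hmid)
      subst hb
      have ha : a = 0 := by simpa using h1
      have hc : c = 0 := by simpa using h2
      simp [ha, hc]
  have hmeas : Measurable F := by
    have hh : Continuous h := by fun_prop
    exact (measurable_deriv h).div (hh.measurable.sub (measurable_id.mul (measurable_deriv h)))
  have hFzero : F 0 = 0 := by
    have := (hd 0).deriv
    rw [zero_smul, add_zero, hef] at this
    simp [F, this]
  obtain ⟨k, hk⟩ := exists_eq_mul_of_midpoint hmeas hFzero hmid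
  have hk0 : k ≠ 0 := by
    rintro rfl
    exact zero_ne_one (hFinj (a₁ := 0) (a₂ := 1) (by simp [hk]))
  have hnorm (t : ℝ) : ‖e + t • f‖ ^ 2 = 1 + k * t ^ 2 := by
    have hsq := sq_eq_of_mul_deriv_eq (fun t => (hd t).differentiableAt.hasDerivAt)
      (fun t => norm_pos_iff.2 (hline t)) hk0 (fun t => by
        have := hk t
        rw [div_eq_iff (hA0 t)] at this
        linear_combination this) t
    simpa [h, he] using hsq
  obtain ⟨x, y, hxy⟩ := hnE
  exact hxy (parallelogram_law_of_norm_add_smul hspan hnorm x y)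
end

section
/- Let X be a strictly convex real normed space. (i) If x and y are smooth points of X with φ(x) = φ(y), then x = y. (ii) If x and y are smooth points of X that are linearly independent, then φ(x) and φ(y) are linearly independent in X*. -/
/-- In a strictly convex space, a functional of norm at most one attains its norm at most once on
each sphere. -/
theorem eq_of_apply_eq_norm_of_norm_eq {X : Type*} [NormedAddCommGroup X] [NormedSpace ℝ X]
    [StrictConvexSpace ℝ X] {f : X →L[ℝ] ℝ} (hf : ‖f‖ ≤ 1) {u v : X} (hu : f u = ‖u‖)
    (hv : f v = ‖v‖) (huv : ‖u‖ = ‖v‖) : u = v := by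
  refine eq_of_norm_eq_of_norm_add_eq huv (le_antisymm (norm_add_le u v) ?_)
  calc ‖u‖ + ‖v‖ = f (u + v) := by rw [map_add, hu, hv]
    _ ≤ ‖f (u + v)‖ := Real.le_norm_self _
    _ ≤ ‖u + v‖ := by simpa using f.le_of_opNorm_le hf (u + v)

/-- In a strictly convex space, if the support functional of `y` is `a` times that of `x`, then
`y` is `a` times `x`. -/
theorem smul_eq_of_smul_dualMap_eq {X : Type*} [NormedAddCommGroup X] [NormedSpace ℝ X]
    [StrictConvexSpace ℝ X] {x y : X} (hx : x ≠ 0) (hy : y ≠ 0)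
    (hdx : DifferentiableAt ℝ (fun z : X => ‖z‖) x)
    (hdy : DifferentiableAt ℝ (fun z : X => ‖z‖) y) {a : ℝ}
    (h : a • ‖x‖ • fderiv ℝ (fun z : X => ‖z‖) x = ‖y‖ • fderiv ℝ (fun z : X => ‖z‖) y) :
    a • x = y := by
  have : Nontrivial X := ⟨x, 0, hx⟩
  have hnx : ‖fderiv ℝ (fun z : X => ‖z‖) x‖ = 1 := norm_fderiv_norm hdx
  have hny : ‖fderiv ℝ (fun z : X => ‖z‖) y‖ = 1 := norm_fderiv_norm hdy
  have hfx : fderiv ℝ (fun z : X => ‖z‖) x x = ‖x‖ := hdx.fderiv_norm_self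
  have hfy : fderiv ℝ (fun z : X => ‖z‖) y y = ‖y‖ := hdy.fderiv_norm_self
  have hnorm : |a| * ‖x‖ = ‖y‖ := by
    simpa [norm_smul, hnx, hny] using congrArg norm h
  have hax : ‖a • x‖ = ‖y‖ := by rw [norm_smul, Real.norm_eq_abs, hnorm]
  refine eq_of_apply_eq_norm_of_norm_eq hny.le ?_ hfy hax
  have happ : a * (‖x‖ * ‖x‖) = ‖y‖ * fderiv ℝ (fun z : X => ‖z‖) y x := by
    simpa [hfx] using congrArg (fun f : X →L[ℝ] ℝ => f x) h
  refine mul_left_cancel₀ (norm_ne_zero_iff.mpr hy) ?_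
  rw [map_smul, smul_eq_mul, hax, mul_left_comm, ← happ, ← hnorm]
  linear_combination (-(‖x‖ * ‖x‖)) * abs_mul_abs_self a

/-- In a strictly convex real normed space, the dual map
`φ(x) = ‖x‖ • D(x)` on smooth points is injective, and sends linearly independent
pairs of smooth points to linearly independent pairs of functionals. -/
theorem dualMap_injective_and_linearIndependent_of_strictlyConvex
    (X : Type*) [NormedAddCommGroup X] [NormedSpace ℝ X]
    (hsc : ∀ x y : X, x ≠ y → ‖x‖ = 1 → ‖y‖ = 1 →
      ∀ t : ℝ, 0 < t → t < 1 → ‖t • x + (1 - t) • y‖ < 1)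
    (x y : X) (hx : x ≠ 0) (hy : y ≠ 0)
    (hdx : DifferentiableAt ℝ (fun z : X => ‖z‖) x)
    (hdy : DifferentiableAt ℝ (fun z : X => ‖z‖) y) :
    ((‖x‖ • fderiv ℝ (fun z : X => ‖z‖) x = ‖y‖ • fderiv ℝ (fun z : X => ‖z‖) y)
        → x = y) ∧
    (LinearIndependent ℝ ![x, y] →
      LinearIndependent ℝ
        ![‖x‖ • fderiv ℝ (fun z : X => ‖z‖) x,
          ‖y‖ • fderiv ℝ (fun z : X => ‖z‖) y]) := by
  have : StrictConvexSpace ℝ X := StrictConvexSpace.of_norm_combo_lt_one fun u v hu hv huv =>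
    ⟨1 / 2, 1 - 1 / 2, by ring, hsc u v huv hu hv (1 / 2) (by norm_num) (by norm_num)⟩
  have : Nontrivial X := ⟨x, 0, hx⟩
  refine ⟨fun h => ?_, fun hli => ?_⟩
  · simpa using smul_eq_of_smul_dualMap_eq hx hy hdx hdy (a := 1) (by rwa [one_smul])
  · have hne : ‖x‖ • fderiv ℝ (fun z : X => ‖z‖) x ≠ 0 := by
      refine smul_ne_zero (norm_ne_zero_iff.mpr hx) (norm_ne_zero_iff.mp ?_)
      rw [norm_fderiv_norm hdx]
      exact one_ne_zero
    rw [LinearIndependent.pair_iff' hx] at hli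
    rw [LinearIndependent.pair_iff' hne]
    exact fun a h => hli a (smul_eq_of_smul_dualMap_eq hx hy hdx hdy h)
end

section
/- Let X be a finite-dimensional real normed space and let x ∈ X be nonzero. Then the set φ[x] := {f ∈ X* : ‖f‖ = ‖x‖ and f(x) = ‖x‖^2} of support functionals of x is a nonempty, compact, convex subset of the dual sphere {f ∈ X* : ‖f‖ = ‖x‖}. If moreover dim X = 2, then φ[x] is a closed segment: there exist f, g ∈ X* with φ[x] = {tf + (1−t)g : t ∈ [0,1]}. -/
/-- A nonempty compact convex set on which some continuous linear functional is injective
is a closed segment. -/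
theorem IsCompact.exists_eq_segment_of_injOn {E : Type*} [AddCommGroup E] [Module ℝ E]
    [TopologicalSpace E] {s : Set E} (hs : IsCompact s) (hne : s.Nonempty)
    (hconv : Convex ℝ s) (l : E →L[ℝ] ℝ) (hl : Set.InjOn l s) :
    ∃ a b : E, s = segment ℝ a b := by
  obtain ⟨a, ha, hmin⟩ := hs.exists_isMinOn hne l.continuous.continuousOn
  obtain ⟨b, hb, hmax⟩ := hs.exists_isMaxOn hne l.continuous.continuousOn
  refine ⟨a, b, Set.Subset.antisymm (fun c hc => ?_) (hconv.segment_subset ha hb)⟩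
  have hab : l a ≤ l b := hmin hb
  have hlc : l c ∈ segment ℝ (l a) (l b) := by
    rw [segment_eq_Icc hab]
    exact ⟨hmin hc, hmax hc⟩
  obtain ⟨t, u, ht, hu, htu, h⟩ := hlc
  refine ⟨t, u, ht, hu, htu, hl (hconv ha hb ht hu htu) hc ?_⟩
  simpa using h

/-- In a two-dimensional space, every nonzero vector is part of a pair of vectors whose images
determine every linear functional. -/
theorem exists_forall_continuousLinearMap_eq_of_finrank_eq_two {E : Type*} [AddCommGroup E]
    [Module ℝ E] [TopologicalSpace E] (hE : Module.finrank ℝ E = 2) {x : E} (hx : x ≠ 0) :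
    ∃ y : E, ∀ f g : E →L[ℝ] ℝ, f x = g x → f y = g y → f = g := by
  obtain ⟨y, hxy⟩ := exists_linearIndependent_pair_of_one_lt_finrank (R := ℝ)
    (by rw [hE]; exact one_lt_two) hx
  refine ⟨y, fun f g hfx hfy => ContinuousLinearMap.coe_injective ?_⟩
  refine (basisOfLinearIndependentOfCardEqFinrank hxy (by simp [hE])).ext fun i => ?_
  fin_cases i <;> simpa

/-- The support functionals of a nonzero vector form the slice of a closed dual ball by an affine
hyperplane. -/
theorem setOf_supportFunctional_eq_closedBall_inter {E : Type*} [NormedAddCommGroup E]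
    [NormedSpace ℝ E] {x : E} (hx : x ≠ 0) :
    {f : E →L[ℝ] ℝ | ‖f‖ = ‖x‖ ∧ f x = ‖x‖ ^ 2} =
      Metric.closedBall 0 ‖x‖ ∩ {f : E →L[ℝ] ℝ | f x = ‖x‖ ^ 2} := by
  ext f
  simp only [Set.mem_ofPred_eq, Set.mem_inter_iff, mem_closedBall_zero_iff]
  refine and_congr_left fun hfx => ⟨le_of_eq, fun hf => hf.antisymm ?_⟩
  have h := (le_abs_self (f x)).trans (f.le_opNorm x)
  rw [hfx, sq] at h
  exact le_of_mul_le_mul_right h (norm_pos_iff.mpr hx)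


/-- For a nonzero point `x` of a finite-dimensional real normed
space, the set of support functionals of `x` is a nonempty, compact, convex subset
of the dual sphere of radius `‖x‖`; in dimension 2 it is a closed segment. -/
theorem supportFunctionals_nonempty_compact_convex_segment
    (X : Type*) [NormedAddCommGroup X] [NormedSpace ℝ X] [FiniteDimensional ℝ X]
    (x : X) (hx : x ≠ 0) :
    ({f : X →L[ℝ] ℝ | ‖f‖ = ‖x‖ ∧ f x = ‖x‖ ^ 2}).Nonempty ∧
    IsCompact {f : X →L[ℝ] ℝ | ‖f‖ = ‖x‖ ∧ f x = ‖x‖ ^ 2} ∧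
    Convex ℝ {f : X →L[ℝ] ℝ | ‖f‖ = ‖x‖ ∧ f x = ‖x‖ ^ 2} ∧
    {f : X →L[ℝ] ℝ | ‖f‖ = ‖x‖ ∧ f x = ‖x‖ ^ 2} ⊆ {f : X →L[ℝ] ℝ | ‖f‖ = ‖x‖} ∧
    (Module.finrank ℝ X = 2 →
      ∃ f g : X →L[ℝ] ℝ,
        {f' : X →L[ℝ] ℝ | ‖f'‖ = ‖x‖ ∧ f' x = ‖x‖ ^ 2} = segment ℝ f g) := by
  set S := {f : X →L[ℝ] ℝ | ‖f‖ = ‖x‖ ∧ f x = ‖x‖ ^ 2} with hS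
  have hslice := setOf_supportFunctional_eq_closedBall_inter hx
  have hne : S.Nonempty := by
    obtain ⟨g, hg, hgx⟩ := exists_dual_vector ℝ x (norm_ne_zero_iff.mpr hx)
    refine ⟨‖x‖ • g, ?_, ?_⟩
    · simp [norm_smul, hg]
    · simp [hgx, sq]
  have hcomp : IsCompact S := by
    have : ProperSpace (X →L[ℝ] ℝ) := FiniteDimensional.proper ℝ _
    rw [hS, hslice]
    exact (isCompact_closedBall _ _).inter_right
      (isClosed_eq (ContinuousLinearMap.apply ℝ ℝ x).continuous continuous_const)
  have hconv : Convex ℝ S := by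
    rw [hS, hslice]
    exact (convex_closedBall _ _).inter
      (convex_hyperplane (ContinuousLinearMap.apply ℝ ℝ x).toLinearMap.isLinear _)
  refine ⟨hne, hcomp, hconv, fun f hf => hf.1, fun hdim => ?_⟩
  obtain ⟨y, hy⟩ := exists_forall_continuousLinearMap_eq_of_finrank_eq_two hdim hx
  exact hcomp.exists_eq_segment_of_injOn hne hconv (ContinuousLinearMap.apply ℝ ℝ y)
    fun f hf g hg hfg => hy f g (hf.2.trans hg.2.symm) hfg
end

section
/- Let X be a finite-dimensional real normed space with dim X ≥ 2. For every smooth point x with ‖x‖ = 1 there exists a smooth point y with ‖y‖ = 1 such that y ≠ x and φ(x), φ(y) are linearly independent in X*. -/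
/-- In a finite-dimensional real normed space of dimension at
least 2, every smooth unit vector `x` admits a smooth unit vector `y ≠ x` whose
support functional is linearly independent from that of `x`. -/
theorem exists_smooth_with_linearIndependent_support
    (X : Type*) [NormedAddCommGroup X] [NormedSpace ℝ X] [FiniteDimensional ℝ X]
    (hdim : 2 ≤ Module.finrank ℝ X)
    (x : X) (hx : ‖x‖ = 1) (hdx : DifferentiableAt ℝ (fun z : X => ‖z‖) x) :
    ∃ y : X, ‖y‖ = 1 ∧ y ≠ x ∧ DifferentiableAt ℝ (fun z : X => ‖z‖) y ∧
      LinearIndependent ℝ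
        ![‖x‖ • fderiv ℝ (fun z : X => ‖z‖) x,
          ‖y‖ • fderiv ℝ (fun z : X => ‖z‖) y] := by
  have : Nontrivial X := ⟨x, 0, norm_ne_zero_iff.mp (by simp [hx])⟩
  set f := fderiv ℝ (fun z : X => ‖z‖) x with hf
  have hfx : f x = 1 := by rw [hf, hdx.fderiv_norm_self, hx]
  have hfn : ‖f‖ = 1 := norm_fderiv_norm hdx
  obtain ⟨z, hz, hz0⟩ : ∃ z ∈ f.ker, z ≠ 0 := by
    refine Submodule.exists_mem_ne_zero_of_ne_bot (LinearMap.ker_ne_bot_of_finrank_lt ?_)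
    rw [Module.finrank_self]
    lia
  have hopen : IsOpen {w : X | |f w| < ‖w‖} :=
    isOpen_lt f.continuous.abs continuous_norm
  have hne : {w : X | |f w| < ‖w‖}.Nonempty := by
    refine ⟨z, ?_⟩
    have h0 : f z = 0 := hz
    simpa [h0] using hz0
  obtain ⟨w, hdw, hw⟩ := dense_differentiableAt_norm.exists_mem_open hopen hne
  have hwpos : 0 < ‖w‖ := (abs_nonneg _).trans_lt hw
  have hy : ‖‖w‖⁻¹ • w‖ = 1 := norm_smul_inv_norm (𝕜 := ℝ) (norm_pos_iff.mp hwpos)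
  have hdy : DifferentiableAt ℝ (fun z : X => ‖z‖) (‖w‖⁻¹ • w) :=
    (differentiableAt_norm_smul (inv_ne_zero hwpos.ne')).mp hdw
  have hfy : |f (‖w‖⁻¹ • w)| < 1 := by
    rw [map_smul, smul_eq_mul, abs_mul, abs_of_pos (inv_pos.mpr hwpos), inv_mul_lt_one₀ hwpos]
    exact hw
  generalize ‖w‖⁻¹ • w = y at hy hdy hfy
  refine ⟨y, hy, ?_, hdy, ?_⟩
  · rintro rfl
    simp [hfx] at hfy
  · have hgy : fderiv ℝ (fun z : X => ‖z‖) y y = 1 := by rw [hdy.fderiv_norm_self, hy]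
    have hgn : ‖fderiv ℝ (fun z : X => ‖z‖) y‖ = 1 := norm_fderiv_norm hdy
    rw [hx, hy, one_smul, one_smul, LinearIndependent.pair_iff]
    generalize fderiv ℝ (fun z : X => ‖z‖) y = g at hgy hgn
    intro a b hab
    have hba : b • g = -(a • f) := (neg_eq_of_add_eq_zero_right hab).symm
    have habs : |b| = |a| := by
      simpa [norm_smul, hfn, hgn] using congrArg norm hba
    have hb : b = -(a * f y) := by simpa [hgy] using congrArg (fun h : X →L[ℝ] ℝ => h y) hba
    have ha : a = 0 := by
      by_contra ha
      have hlt := mul_lt_of_lt_one_right (abs_pos.mpr ha) hfy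
      rw [← abs_mul, ← abs_neg, ← hb, habs] at hlt
      exact hlt.false
    exact ⟨ha, by simpa [ha] using hb⟩
end

section
/- Let X be a finite-dimensional real normed space, G a finite simple graph, V a nonempty proper subset of V(G), and p : V → X such that the norm of X is Fréchet differentiable at p_v − p_w for every edge vw of G with both endpoints v, w ∈ V. Then the set W := {q : V(G)∖V → X : the combined placement (q on V(G)∖V, p on V) of G is well-positioned} is dense in the space of maps V(G)∖V → X, and the complement of W is null with respect to any additive Haar measure on that finite-dimensional space. -/
open MeasureTheory

/-- If `A` is Lipschitz and translates along the linear map `R` as `A (q + R x) = A q + x`,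
then the norm is differentiable at `A q` for almost every `q`. -/
theorem ae_differentiableAt_norm_of_translate {E X : Type*}
    [NormedAddCommGroup E] [NormedSpace ℝ E] [FiniteDimensional ℝ E]
    [MeasurableSpace E] [BorelSpace E] [NormedAddCommGroup X] [NormedSpace ℝ X]
    (μ : Measure E) [μ.IsAddHaarMeasure] {C : NNReal} {A : E → X} (hA : LipschitzWith C A)
    (R : X →L[ℝ] E) (hR : ∀ q x, A (q + R x) = A q + x) :
    ∀ᵐ q ∂μ, DifferentiableAt ℝ (fun x : X => ‖x‖) (A q) := by
  filter_upwards [(lipschitzWith_one_norm.comp hA).ae_differentiableAt (μ := μ)] with q hq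
  have hnorm : (fun x : X => ‖x‖) = (norm ∘ A) ∘ fun x => q + R (x - A q) := by
    funext x
    simp only [Function.comp_apply, hR, add_sub_cancel]
  rw [hnorm]
  refine DifferentiableAt.comp _ ?_ (by fun_prop)
  simpa using hq

/-- The placement of all vertices obtained from `p` on `S` and `q` off `S` depends on `q` in a
1-Lipschitz way at each vertex. -/
theorem lipschitzWith_combined_placement {V X : Type*} [NormedAddCommGroup X]
    (S : Set V) [DecidablePred (· ∈ S)] [Fintype ↥Sᶜ] (p : S → X) (v : V) :
    LipschitzWith 1 fun q : ↥Sᶜ → X => if hv : v ∈ S then p ⟨v, hv⟩ else q ⟨v, hv⟩ := by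
  by_cases hv : v ∈ S
  · simpa [hv] using (LipschitzWith.const (p ⟨v, hv⟩)).weaken zero_le_one
  · simpa [hv] using LipschitzWith.eval (α := fun _ : ↥Sᶜ => X) ⟨v, hv⟩

/-- Almost every completion of a partial placement whose internal edges are well-positioned is
well-positioned. -/
theorem ae_wellPositioned_completion {X V : Type*}
    [NormedAddCommGroup X] [NormedSpace ℝ X] [FiniteDimensional ℝ X]
    [Finite V] (G : SimpleGraph V) (S : Set V) [DecidablePred (· ∈ S)] [Fintype ↥Sᶜ] (p : S → X)
    (hp : ∀ (v w : V) (hv : v ∈ S) (hw : w ∈ S), G.Adj v w →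
      DifferentiableAt ℝ (fun x : X => ‖x‖) (p ⟨v, hv⟩ - p ⟨w, hw⟩))
    [MeasurableSpace (↥Sᶜ → X)] [BorelSpace (↥Sᶜ → X)]
    (μ : Measure (↥Sᶜ → X)) [μ.IsAddHaarMeasure] :
    ∀ᵐ q ∂μ, ∀ v w : V, G.Adj v w →
      DifferentiableAt ℝ (fun x : X => ‖x‖)
        ((if hv : v ∈ S then p ⟨v, hv⟩ else q ⟨v, hv⟩)
          - (if hw : w ∈ S then p ⟨w, hw⟩ else q ⟨w, hw⟩)) := by
  classical
  simp only [ae_all_iff]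
  intro v w hvw
  have hlip := (lipschitzWith_combined_placement S p v).sub
    (lipschitzWith_combined_placement S p w)
  by_cases hv : v ∈ S
  · by_cases hw : w ∈ S
    · simp [hv, hw, hp v w hv hw hvw]
    · refine ae_differentiableAt_norm_of_translate μ hlip
        (-ContinuousLinearMap.single ℝ (fun _ : ↥Sᶜ => X) ⟨w, hw⟩) fun q x => ?_
      simp only [hv, hw, dite_true, dite_false, neg_apply,
        ContinuousLinearMap.single_apply, Pi.add_apply, Pi.neg_apply, Pi.single_eq_same]
      abel
  · refine ae_differentiableAt_norm_of_translate μ hlip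
      (ContinuousLinearMap.single ℝ (fun _ : ↥Sᶜ => X) ⟨v, hv⟩) fun q x => ?_
    by_cases hw : w ∈ S
    · simp only [hv, hw, dite_true, dite_false, ContinuousLinearMap.single_apply,
        Pi.add_apply, Pi.single_eq_same]
      abel
    · have hne : (⟨w, hw⟩ : ↥Sᶜ) ≠ ⟨v, hv⟩ := fun h => hvw.ne (congrArg Subtype.val h).symm
      simp only [hv, hw, dite_false, ContinuousLinearMap.single_apply,
        Pi.add_apply, Pi.single_eq_same, Pi.single_eq_of_ne hne]
      abel

/-- Given a partial placement `p` on a nonempty proper vertex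
subset `S` whose internal edges are all well-positioned, the set of completions of
`p` to a well-positioned placement of `G` is dense, and its complement is null for
every additive Haar measure on the space of completions. -/
theorem wellPositioned_completions_dense_and_conull
    (X : Type*) [NormedAddCommGroup X] [NormedSpace ℝ X] [FiniteDimensional ℝ X]
    (V : Type*) [Fintype V] (G : SimpleGraph V)
    (S : Set V) [DecidablePred (· ∈ S)] (hS : S.Nonempty) (hS' : S ≠ Set.univ)
    (p : S → X)
    (hp : ∀ (v w : V) (hv : v ∈ S) (hw : w ∈ S), G.Adj v w →
      DifferentiableAt ℝ (fun x : X => ‖x‖) (p ⟨v, hv⟩ - p ⟨w, hw⟩))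
    [MeasurableSpace ((↥Sᶜ) → X)] [BorelSpace ((↥Sᶜ) → X)] :
    Dense {q : (↥Sᶜ) → X | ∀ v w : V, G.Adj v w →
      DifferentiableAt ℝ (fun x : X => ‖x‖)
        ((if hv : v ∈ S then p ⟨v, hv⟩ else q ⟨v, hv⟩)
          - (if hw : w ∈ S then p ⟨w, hw⟩ else q ⟨w, hw⟩))} ∧
    ∀ μ : Measure ((↥Sᶜ) → X), μ.IsAddHaarMeasure →
      μ {q : (↥Sᶜ) → X | ∀ v w : V, G.Adj v w →
        DifferentiableAt ℝ (fun x : X => ‖x‖)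
          ((if hv : v ∈ S then p ⟨v, hv⟩ else q ⟨v, hv⟩)
            - (if hw : w ∈ S then p ⟨w, hw⟩ else q ⟨w, hw⟩))}ᶜ = 0 := by
  classical
  have hae := fun (μ : Measure (↥Sᶜ → X)) (_ : μ.IsAddHaarMeasure) =>
    ae_wellPositioned_completion G S p hp μ
  exact ⟨Measure.dense_of_ae (hae Measure.addHaar inferInstance),
    fun μ hμ => mem_ae_iff.mp (hae μ hμ)⟩
end

section
/- Let X be a real normed space, let x₁, x₂ ∈ X be such that the segment [x₁, x₂] = {tx₁ + (1−t)x₂ : t ∈ [0,1]} is contained in the unit sphere of X, and let x, y be smooth points lying in [x₁, x₂]. Then φ(x) = φ(y). -/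
/-- The derivative of the norm at `x` vanishes on `y - x` if the norm is constant on the
segment from `x` to `y`. -/
theorem fderiv_norm_sub_eq_zero_of_norm_eq_on_segment
    {X : Type*} [NormedAddCommGroup X] [NormedSpace ℝ X] {x y : X} {c : ℝ}
    (hseg : ∀ z ∈ segment ℝ x y, ‖z‖ = c)
    (hdx : DifferentiableAt ℝ (fun z : X => ‖z‖) x) :
    fderiv ℝ (fun z : X => ‖z‖) x (y - x) = 0 := by
  have hline : HasDerivAt (fun t : ℝ => x + t • (y - x)) (y - x) 0 := by
    simpa using ((hasDerivAt_id (0 : ℝ)).smul_const (y - x)).const_add x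
  have hdx' : HasFDerivAt (fun z : X => ‖z‖) (fderiv ℝ (fun z : X => ‖z‖) x)
      (x + (0 : ℝ) • (y - x)) := by
    simpa using hdx.hasFDerivAt
  have hcomp := (hdx'.comp_hasDerivAt (0 : ℝ) hline).hasDerivWithinAt (s := Set.Icc 0 1)
  have hc : ∀ t ∈ Set.Icc (0 : ℝ) 1, ‖x + t • (y - x)‖ = c := fun t ht =>
    hseg _ (by rw [segment_eq_image']; exact ⟨t, ht, rfl⟩)
  have hconst : HasDerivWithinAt ((fun z : X => ‖z‖) ∘ fun t : ℝ => x + t • (y - x)) 0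
      (Set.Icc 0 1) 0 :=
    (hasDerivWithinAt_const (0 : ℝ) (Set.Icc 0 1) c).congr hc
      (hc 0 (Set.left_mem_Icc.2 zero_le_one))
  exact (uniqueDiffOn_Icc zero_lt_one 0 (Set.left_mem_Icc.2 zero_le_one)).eq_deriv _ hcomp hconst

/-- A functional dominated by the norm and attaining it at `y` is the derivative of the norm
at `y`. -/
theorem fderiv_norm_eq_of_le_norm_of_eq
    {X : Type*} [NormedAddCommGroup X] [NormedSpace ℝ X] {y : X} {f : X →L[ℝ] ℝ}
    (hf : ∀ z, f z ≤ ‖z‖) (hfy : f y = ‖y‖)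
    (hdy : DifferentiableAt ℝ (fun z : X => ‖z‖) y) :
    fderiv ℝ (fun z : X => ‖z‖) y = f := by
  have hmin : IsLocalMin (fun z : X => ‖z‖ - f z) y :=
    Filter.Eventually.of_forall fun z => by
      simpa [hfy] using hf z
  exact sub_eq_zero.1 (hmin.hasFDerivAt_eq_zero (hdy.hasFDerivAt.sub f.hasFDerivAt))

/-- If a segment `[x₁, x₂]` is contained in the unit sphere of a
real normed space, then all smooth points of the segment share the same support
functional. -/
theorem support_functional_constant_on_sphere_segment
    (X : Type*) [NormedAddCommGroup X] [NormedSpace ℝ X]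
    (x₁ x₂ : X) (hseg : segment ℝ x₁ x₂ ⊆ {z : X | ‖z‖ = 1})
    (x y : X) (hx : x ∈ segment ℝ x₁ x₂) (hy : y ∈ segment ℝ x₁ x₂)
    (hx0 : x ≠ 0) (hy0 : y ≠ 0)
    (hdx : DifferentiableAt ℝ (fun z : X => ‖z‖) x)
    (hdy : DifferentiableAt ℝ (fun z : X => ‖z‖) y) :
    ‖x‖ • fderiv ℝ (fun z : X => ‖z‖) x = ‖y‖ • fderiv ℝ (fun z : X => ‖z‖) y := by
  have hx1 : ‖x‖ = 1 := hseg hx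
  have hy1 : ‖y‖ = 1 := hseg hy
  have hsub := fderiv_norm_sub_eq_zero_of_norm_eq_on_segment
    (fun z hz => hseg ((convex_segment x₁ x₂).segment_subset hx hy hz)) hdx
  have hself : fderiv ℝ (fun z : X => ‖z‖) x x = ‖x‖ := hdx.fderiv_norm_self
  have hnorm : ‖fderiv ℝ (fun z : X => ‖z‖) x‖ ≤ 1 := by
    simpa using norm_fderiv_le_of_lipschitz ℝ (x₀ := x) (lipschitzWith_one_norm (E := X))
  rw [map_sub, sub_eq_zero, hself] at hsub
  rw [hx1, hy1, one_smul, one_smul]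
  refine (fderiv_norm_eq_of_le_norm_of_eq (fun z => ?_) (by rw [hsub, hx1, hy1]) hdy).symm
  simpa using (le_abs_self _).trans ((fderiv ℝ (fun z : X => ‖z‖) x).le_of_opNorm_le hnorm z)
end

section
/- Let X be a two-dimensional real normed space, let x be a smooth point with ‖x‖ = 1, and suppose {z ∈ X : φ(x)(z) = 1 and ‖z‖ = 1} equals the segment [x₁, x₂] = {tx₁ + (1−t)x₂ : t ∈ [0,1]} with x₁ ≠ x₂. Let y be a smooth point with ‖y‖ = 1 and write y = a x₁ + b x₂ with a, b ∈ ℝ. Then: (i) if a, b ≥ 0 or a, b ≤ 0, then φ(x) and φ(y) are linearly dependent in X*; (ii) if a < 0 < b or b < 0 < a, then φ(x) and φ(y) are linearly independent in X*. -/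
theorem abs_fderiv_norm_apply_le_s11 {E : Type*} [NormedAddCommGroup E] [NormedSpace ℝ E] (x z : E) :
    |fderiv ℝ (fun w : E => ‖w‖) x z| ≤ ‖z‖ := by
  have h : ‖fderiv ℝ (fun w : E => ‖w‖) x‖ ≤ 1 := by
    simpa using norm_fderiv_le_of_lipschitz ℝ (x₀ := x) (lipschitzWith_one_norm (E := E))
  simpa using (fderiv ℝ (fun w : E => ‖w‖) x).le_of_opNorm_le h z

/-- At a smooth point, the derivative of the norm is the only support functional. -/
theorem eq_fderiv_norm_of_le_norm {E : Type*} [NormedAddCommGroup E] [NormedSpace ℝ E] {y : E}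
    (hdy : DifferentiableAt ℝ (fun w : E => ‖w‖) y) {h : E →L[ℝ] ℝ}
    (hle : ∀ z, h z ≤ ‖z‖) (hy : h y = ‖y‖) :
    h = fderiv ℝ (fun w : E => ‖w‖) y := by
  have hmin : IsLocalMin (fun w : E => ‖w‖ - h w) y :=
    Filter.Eventually.of_forall fun z => by simpa [hy] using hle z
  have := hmin.hasFDerivAt_eq_zero (hdy.hasFDerivAt.sub h.hasFDerivAt)
  exact (sub_eq_zero.mp this).symm

/-- A nonnegative combination of norm one of the endpoints of a segment in the unit sphere
has coefficients summing to one. -/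
theorem add_eq_one_of_segment_subset_sphere {E : Type*} [NormedAddCommGroup E] [NormedSpace ℝ E]
    {x₁ x₂ : E} (hseg : ∀ z ∈ segment ℝ x₁ x₂, ‖z‖ = 1) {a b : ℝ} (ha : 0 ≤ a) (hb : 0 ≤ b)
    (hab : ‖a • x₁ + b • x₂‖ = 1) : a + b = 1 := by
  have hne : a + b ≠ 0 := by
    intro h
    have h₁ : a = 0 := by linarith
    have h₂ : b = 0 := by linarith
    simp [h₁, h₂] at hab
  have hpos : 0 ≤ a + b := add_nonneg ha hb
  have hmem : (a / (a + b)) • x₁ + (b / (a + b)) • x₂ ∈ segment ℝ x₁ x₂ :=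
    ⟨_, _, div_nonneg ha hpos, div_nonneg hb hpos, by field_simp, rfl⟩
  have hsum : a • x₁ + b • x₂ = (a + b) • ((a / (a + b)) • x₁ + (b / (a + b)) • x₂) := by
    rw [smul_add, smul_smul, smul_smul, mul_div_cancel₀ _ hne, mul_div_cancel₀ _ hne]
  rw [hsum, norm_smul, hseg _ hmem, Real.norm_of_nonneg hpos, mul_one] at hab
  exact hab

theorem nonneg_of_combination_mem_segment {E : Type*} [AddCommGroup E] [Module ℝ E] {x₁ x₂ : E}
    (hne : x₁ ≠ x₂) {a b : ℝ} (hab : a + b = 1) (h : a • x₁ + b • x₂ ∈ segment ℝ x₁ x₂) :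
    0 ≤ a ∧ 0 ≤ b := by
  obtain ⟨p, q, hp, hq, hpq, h⟩ := h
  obtain rfl : q = 1 - p := by linarith
  obtain rfl : b = 1 - a := by linarith
  have h₀ : (p - a) • (x₁ - x₂) = 0 := by
    rw [← sub_eq_zero] at h
    rw [← h]
    module
  have hpa : p = a := sub_eq_zero.mp ((smul_eq_zero.mp h₀).resolve_right (sub_ne_zero.mpr hne))
  subst hpa
  exact ⟨hp, hq⟩

/-- Let `x` be a smooth unit vector of a normed plane whose face
`{z : φ(x) z = 1, ‖z‖ = 1}` is a nondegenerate segment `[x₁, x₂]`, and let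
`y = a x₁ + b x₂` be a smooth unit vector. If `a, b` have the same sign then
`φ(x), φ(y)` are linearly dependent; if they have strictly opposite signs then
`φ(x), φ(y)` are linearly independent. -/
theorem support_functional_face_dependence
    (X : Type*) [NormedAddCommGroup X] [NormedSpace ℝ X]
    (hdim : Module.finrank ℝ X = 2)
    (x : X) (hx1 : ‖x‖ = 1) (hdx : DifferentiableAt ℝ (fun z : X => ‖z‖) x)
    (x₁ x₂ : X) (hx12 : x₁ ≠ x₂)
    (hface : {z : X | (‖x‖ • fderiv ℝ (fun z : X => ‖z‖) x) z = 1 ∧ ‖z‖ = 1}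
      = segment ℝ x₁ x₂)
    (y : X) (hy1 : ‖y‖ = 1) (hdy : DifferentiableAt ℝ (fun z : X => ‖z‖) y)
    (a b : ℝ) (hy : y = a • x₁ + b • x₂) :
    (((0 ≤ a ∧ 0 ≤ b) ∨ (a ≤ 0 ∧ b ≤ 0)) →
      ¬ LinearIndependent ℝ
        ![‖x‖ • fderiv ℝ (fun z : X => ‖z‖) x,
          ‖y‖ • fderiv ℝ (fun z : X => ‖z‖) y]) ∧
    (((a < 0 ∧ 0 < b) ∨ (b < 0 ∧ 0 < a)) →
      LinearIndependent ℝ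
        ![‖x‖ • fderiv ℝ (fun z : X => ‖z‖) x,
          ‖y‖ • fderiv ℝ (fun z : X => ‖z‖) y]) := by
  have hgx := abs_fderiv_norm_apply_le_s11 y x
  have hfy := abs_fderiv_norm_apply_le_s11 x y
  have hfle := abs_fderiv_norm_apply_le_s11 x
  have hfx : fderiv ℝ (fun z : X => ‖z‖) x x = ‖x‖ := hdx.fderiv_norm_self
  have hgy : fderiv ℝ (fun z : X => ‖z‖) y y = ‖y‖ := hdy.fderiv_norm_self
  have huniq := fun h : X →L[ℝ] ℝ => eq_fderiv_norm_of_le_norm (h := h) hdy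
  simp only [hx1, hy1, one_smul] at hface hgx hfy hfx hgy huniq ⊢
  generalize fderiv ℝ (fun z : X => ‖z‖) x = f at *
  generalize fderiv ℝ (fun z : X => ‖z‖) y = g at *
  have hmem : ∀ z, z ∈ segment ℝ x₁ x₂ ↔ f z = 1 ∧ ‖z‖ = 1 := fun z => by rw [← hface]; rfl
  have hf₁ : f x₁ = 1 := ((hmem _).mp (left_mem_segment ℝ x₁ x₂)).1
  have hf₂ : f x₂ = 1 := ((hmem _).mp (right_mem_segment ℝ x₁ x₂)).1
  have hfab : f y = a + b := by simp [hy, hf₁, hf₂]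
  have hyneg : -y = (-a) • x₁ + (-b) • x₂ := by rw [hy]; module
  have hsphere : ∀ z ∈ segment ℝ x₁ x₂, ‖z‖ = 1 := fun z hz => ((hmem z).mp hz).2
  constructor
  · rintro (⟨ha, hb⟩ | ⟨ha, hb⟩) hli
    · have hab := add_eq_one_of_segment_subset_sphere hsphere ha hb (hy ▸ hy1)
      have hfg : f = g := huniq f (fun z => (le_abs_self _).trans (hfle z)) (hfab.trans hab)
      have := LinearIndependent.pair_iff.mp hli 1 (-1) (by simp [hfg])
      norm_num at this
    · have hab := add_eq_one_of_segment_subset_sphere hsphere (neg_nonneg.mpr ha)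
        (neg_nonneg.mpr hb) (by rw [← hyneg, norm_neg, hy1])
      have hfg : -f = g := huniq (-f) (fun z => (neg_le_abs _).trans (hfle z))
        (by rw [neg_apply, hfab]; linarith)
      have := LinearIndependent.pair_iff.mp hli 1 1 (by simp [← hfg])
      norm_num at this
  · intro hsign
    have hne₁ : f y ≠ 1 := fun h => by
      have := nonneg_of_combination_mem_segment hx12 (hfab ▸ h) (hy ▸ (hmem y).mpr ⟨h, hy1⟩)
      grind
    have hne₂ : f y ≠ -1 := fun h => by
      have := nonneg_of_combination_mem_segment (a := -a) (b := -b) hx12 (by linarith)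
        (hyneg ▸ (hmem (-y)).mpr ⟨by simp [h], by rw [norm_neg, hy1]⟩)
      grind
    have hlt : |f y| < 1 := lt_of_le_of_ne hfy fun h => by
      rcases eq_or_eq_neg_of_abs_eq h with h | h
      exacts [hne₁ h, hne₂ h]
    refine LinearIndependent.pair_iff.mpr fun s t hst => ?_
    have hs : s + t * g x = 0 := by simpa [hfx] using DFunLike.congr_fun hst x
    have ht : s * f y + t = 0 := by simpa [hgy] using DFunLike.congr_fun hst y
    have hprod : f y * g x ≠ 1 := fun h => by
      have : |f y| * |g x| = 1 := by rw [← abs_mul, h, abs_one]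
      nlinarith [abs_nonneg (f y), abs_nonneg (g x)]
    have hs₀ : s = 0 := by
      have : s * (1 - f y * g x) = 0 := by linear_combination hs - g x * ht
      exact (mul_eq_zero.mp this).resolve_right (sub_ne_zero.mpr hprod.symm)
    exact ⟨hs₀, by simpa [hs₀] using ht⟩
end

section
/- Let X be a two-dimensional real normed space, let x₁, x₂ ∈ X be linearly independent with ‖x₁‖ = ‖x₂‖ = 1, and let f ∈ X* satisfy ‖f‖ = 1 and f(x₁) = f(x₂) = 1 (so f is a support functional of both x₁ and x₂). Then: (i) for every y = a x₁ + b x₂ with a, b ≥ 0 one has f(y) = ‖y‖, i.e. ‖y‖·f is a support functional of y; (ii) every y = a x₁ + b x₂ with a, b > 0 is a smooth point of X. -/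
/-- A functional of norm at most one that attains the norm at `x₁` and `x₂` attains it on the
closed cone they span. -/
theorem apply_cone_eq_norm {X : Type*} [NormedAddCommGroup X] [NormedSpace ℝ X]
    {x₁ x₂ : X} {f : X →L[ℝ] ℝ} (hf : ‖f‖ ≤ 1) (h₁ : f x₁ = ‖x₁‖) (h₂ : f x₂ = ‖x₂‖)
    {a b : ℝ} (ha : 0 ≤ a) (hb : 0 ≤ b) :
    f (a • x₁ + b • x₂) = ‖a • x₁ + b • x₂‖ := by
  apply le_antisymm
  · exact (le_abs_self _).trans (by simpa using f.le_of_opNorm_le hf (a • x₁ + b • x₂))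
  · calc ‖a • x₁ + b • x₂‖ ≤ ‖a • x₁‖ + ‖b • x₂‖ := norm_add_le _ _
      _ = f (a • x₁ + b • x₂) := by
        simp [norm_smul, abs_of_nonneg ha, abs_of_nonneg hb, h₁, h₂]

/-- In a plane, the open cone spanned by two linearly independent vectors is a neighbourhood of
each of its points. -/
theorem eventually_mem_open_cone {X : Type*} [NormedAddCommGroup X] [NormedSpace ℝ X]
    (hdim : Module.finrank ℝ X = 2) {x₁ x₂ : X} (hli : LinearIndependent ℝ ![x₁, x₂])
    {a b : ℝ} (ha : 0 < a) (hb : 0 < b) :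
    ∀ᶠ z in nhds (a • x₁ + b • x₂), ∃ s t : ℝ, 0 < s ∧ 0 < t ∧ z = s • x₁ + t • x₂ := by
  have : FiniteDimensional ℝ X := Module.finite_of_finrank_eq_succ hdim
  let B : Module.Basis (Fin 2) ℝ X :=
    basisOfLinearIndependentOfCardEqFinrank hli (by simp [hdim])
  have hB₀ : B 0 = x₁ := by simp [B]
  have hB₁ : B 1 = x₂ := by simp [B]
  have hc (i : Fin 2) : Continuous (B.coord i) := (B.coord i).continuous_of_finiteDimensional
  have h₀ : 0 < B.coord 0 (a • x₁ + b • x₂) := by simpa [← hB₀, ← hB₁] using ha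
  have h₁ : 0 < B.coord 1 (a • x₁ + b • x₂) := by simpa [← hB₀, ← hB₁] using hb
  filter_upwards [(hc 0).continuousAt.eventually (lt_mem_nhds h₀),
    (hc 1).continuousAt.eventually (lt_mem_nhds h₁)] with z hz₀ hz₁
  refine ⟨B.coord 0 z, B.coord 1 z, hz₀, hz₁, ?_⟩
  have hz := B.sum_repr z
  rw [Fin.sum_univ_two, hB₀, hB₁] at hz
  exact hz.symm

/-- If `f` is a common support functional of two linearly
independent unit vectors `x₁, x₂` of a normed plane, then `f` supports every point
of the closed cone on `[x₁, x₂]`, and every point of the open cone is smooth. -/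
theorem cone_support_and_smoothness
    (X : Type*) [NormedAddCommGroup X] [NormedSpace ℝ X]
    (hdim : Module.finrank ℝ X = 2)
    (x₁ x₂ : X) (hx₁ : ‖x₁‖ = 1) (hx₂ : ‖x₂‖ = 1)
    (hli : LinearIndependent ℝ ![x₁, x₂])
    (f : X →L[ℝ] ℝ) (hf : ‖f‖ = 1) (hfx₁ : f x₁ = 1) (hfx₂ : f x₂ = 1) :
    (∀ a b : ℝ, 0 ≤ a → 0 ≤ b → f (a • x₁ + b • x₂) = ‖a • x₁ + b • x₂‖) ∧
    (∀ a b : ℝ, 0 < a → 0 < b →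
      DifferentiableAt ℝ (fun z : X => ‖z‖) (a • x₁ + b • x₂)) := by
  have hcone {a b : ℝ} (ha : 0 ≤ a) (hb : 0 ≤ b) :
      f (a • x₁ + b • x₂) = ‖a • x₁ + b • x₂‖ :=
    apply_cone_eq_norm hf.le (hfx₁.trans hx₁.symm) (hfx₂.trans hx₂.symm) ha hb
  refine ⟨fun a b ha hb => hcone ha hb, fun a b ha hb => ?_⟩
  refine f.differentiableAt.congr_of_eventuallyEq ?_
  filter_upwards [eventually_mem_open_cone hdim hli ha hb] with z hz
  obtain ⟨s, t, hs, ht, rfl⟩ := hz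
  exact (hcone hs.le ht.le).symm
end

section
/- Let X be a finite-dimensional real normed space of dimension at least 1. For every z ∈ X there exist smooth points x, y ∈ X with x + y = z such that x − y is also a smooth point; moreover, if z ≠ 0 and z is not a smooth point, then x and y can be chosen linearly independent. -/
/-- In a finite-dimensional real normed space of dimension at
least 1, every point `z` can be written as `z = x + y` with `x`, `y` and `x − y`
smooth points; if `z` is nonzero and non-smooth, `x` and `y` may moreover be
chosen linearly independent. -/
theorem exists_smooth_decomposition
    (X : Type*) [NormedAddCommGroup X] [NormedSpace ℝ X] [FiniteDimensional ℝ X]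
    (hdim : 1 ≤ Module.finrank ℝ X) (z : X) :
    ∃ x y : X, x ≠ 0 ∧ DifferentiableAt ℝ (fun w : X => ‖w‖) x ∧
      y ≠ 0 ∧ DifferentiableAt ℝ (fun w : X => ‖w‖) y ∧
      x + y = z ∧
      x - y ≠ 0 ∧ DifferentiableAt ℝ (fun w : X => ‖w‖) (x - y) ∧
      (z ≠ 0 → ¬ DifferentiableAt ℝ (fun w : X => ‖w‖) z →
        LinearIndependent ℝ ![x, y]) := by
  have : Nontrivial X := Module.nontrivial_of_finrank_pos (R := ℝ) hdim
  borelize X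
  let μ : MeasureTheory.Measure X := MeasureTheory.Measure.addHaar
  have hsmooth : ∀ᵐ w ∂μ, DifferentiableAt ℝ (fun w : X => ‖w‖) w := ae_differentiableAt_norm
  have hne : ∀ {w : X}, DifferentiableAt ℝ (fun w : X => ‖w‖) w → w ≠ 0 := by
    rintro _ hw rfl
    exact not_differentiableAt_norm_zero X hw
  have hsub := (MeasureTheory.Measure.measurePreserving_sub_left μ z).quasiMeasurePreserving.ae
    hsmooth
  have hmid := (MeasureTheory.measurePreserving_sub_right μ
    ((2 : ℝ)⁻¹ • z)).quasiMeasurePreserving.ae hsmooth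
  obtain ⟨x, hx, hy, hxy⟩ := (hsmooth.and (hsub.and hmid)).exists
  have hdiff : DifferentiableAt ℝ (fun w : X => ‖w‖) (x - (z - x)) := by
    have h := (differentiableAt_norm_smul (x := x - (2 : ℝ)⁻¹ • z) (two_ne_zero (α := ℝ))).1 hxy
    convert h using 1
    module
  refine ⟨x, z - x, hne hx, hx, hne hy, hy, add_sub_cancel x z, hne hdiff, hdiff, ?_⟩
  intro hz hzs
  rw [linearIndependent_fin2]
  refine ⟨hne hy, fun t ht => hzs ?_⟩
  have hzt : (t + 1) • (z - x) = z := by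
    have ht' : t • (z - x) = x := ht
    rw [add_smul, ht', one_smul, add_sub_cancel]
  have ht0 : t + 1 ≠ 0 := by
    intro h
    rw [h, zero_smul] at hzt
    exact hz hzt.symm
  have h := (differentiableAt_norm_smul (x := z - x) ht0).1 hy
  rwa [hzt] at h
end

section
/- Let X be a strictly convex two-dimensional real normed space, let z ∈ X be a non-smooth point with ‖z‖ = 1, and suppose the set φ[z] of support functionals of z equals {tf + (1−t)g : t ∈ [0,1]} for some f, g ∈ X* with f ≠ g. Let (z_n) be a sequence of smooth points with ‖z_n‖ = 1 converging to z. Then: (i) the sequence (φ(z_n)) in X* has a convergent subsequence; (ii) if φ(z_n) → h, then h = f or h = g; (iii) if φ(z_n) → h and (f−g)(z_n) > 0 for all sufficiently large n, then h = f; (iv) if φ(z_n) → h and (f−g)(z_n) < 0 for all sufficiently large n, then h = g. -/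
open Filter

/-- A limit `f - b • k`, `0 ≤ b`, of norm-one support functionals at points `zs n → z` lying
frequently on the positive side of `k` is `f` itself. -/
theorem support_functional_limit_eq_of_frequently_pos
    {X : Type*} [NormedAddCommGroup X] [NormedSpace ℝ X]
    {z v : X} {f k h : X →L[ℝ] ℝ} {b : ℝ} (hz : ‖z‖ = 1) (hfz : f z = 1) (hf : ‖f‖ = 1)
    (hkv : k v = 1) (hrep : ∀ w, w = f w • z + k w • v) (hh : h = f - b • k) (hb : 0 ≤ b)
    {zs : ℕ → X} (hzs1 : ∀ n, ‖zs n‖ = 1) (hzslim : Tendsto zs atTop (nhds z))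
    {φ : ℕ → X →L[ℝ] ℝ} (hφ1 : ∀ n, ‖φ n‖ = 1) (hφ : ∀ n, φ n (zs n) = 1)
    (hlim : Tendsto φ atTop (nhds h)) (hpos : ∃ᶠ n in atTop, 0 < k (zs n)) :
    h = f := by
  have hfw : ∀ᶠ n in atTop, 0 < f (zs n) := by
    have := (f.continuous.tendsto z).comp hzslim
    rw [hfz] at this
    exact this.eventually (lt_mem_nhds one_pos)
  have hv : Tendsto (fun n => φ n v) atTop (nhds (h v)) :=
    ((ContinuousLinearMap.apply ℝ ℝ v).continuous.tendsto h).comp hlim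
  have key : f v ≤ h v := by
    refine ge_of_tendsto_of_frequently hv ((hpos.and_eventually hfw).mono ?_)
    rintro n ⟨hk, hf0⟩
    have h1 : φ n z ≤ 1 := by
      simpa [hz, hφ1 n] using (le_abs_self _).trans ((φ n).le_opNorm z)
    have h2 : f (zs n) ≤ 1 := by
      simpa [hzs1 n, hf] using (le_abs_self _).trans (f.le_opNorm (zs n))
    have h3 : φ n (zs n) = f (zs n) * φ n z + k (zs n) * φ n v := by
      conv_lhs => rw [hrep (zs n)]
      simp
    have h4 : f (zs n) = f (zs n) * f z + k (zs n) * f v := by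
      conv_lhs => rw [hrep (zs n)]
      simp
    rw [hφ n] at h3
    rw [hfz] at h4
    by_contra! hlt
    nlinarith [mul_lt_mul_of_pos_left hlt hk, mul_le_mul_of_nonneg_left h1 hf0.le]
  have hb0 : b = 0 := by
    rw [hh] at key
    simp [hkv] at key
    linarith
  simp [hh, hb0]

/-- On a plane, functionals `f`, `k ≠ 0` with `f z = 1` and `k z = 0` are the coordinates of a
basis containing `z`. -/
theorem exists_dual_vector_of_ne
    {X : Type*} [NormedAddCommGroup X] [NormedSpace ℝ X] (hdim : Module.finrank ℝ X = 2)
    {z : X} {f k : X →L[ℝ] ℝ} (hfz : f z = 1) (hkz : k z = 0) (hk : k ≠ 0) :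
    ∃ v, k v = 1 ∧ ∀ w, w = f w • z + k w • v := by
  obtain ⟨u, hu⟩ : ∃ u, k u ≠ 0 := by
    by_contra! hc
    exact hk (ContinuousLinearMap.ext hc)
  set v := (k u)⁻¹ • (u - f u • z) with hv
  have hkv : k v = 1 := by simp [hv, hkz, hu]
  have hfv : f v = 0 := by simp [hv, hfz]
  refine ⟨v, hkv, fun w => ?_⟩
  have hli : LinearIndependent ℝ ![z, v] := by
    rw [LinearIndependent.pair_iff]
    intro s t hst
    have h1 := congrArg f hst
    have h2 := congrArg k hst
    simp [hfz, hfv, hkz, hkv] at h1 h2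
    exact ⟨h1, h2⟩
  have hfin : FiniteDimensional ℝ X := Module.finite_of_finrank_pos (by omega)
  have hspan := hli.span_eq_top_of_card_eq_finrank' (by simp [hdim])
  have hw : w ∈ Submodule.span ℝ (Set.range ![z, v]) := hspan ▸ Submodule.mem_top
  rw [Matrix.range_cons, Matrix.range_cons, Matrix.range_empty, Set.union_empty,
    Set.singleton_union, Submodule.mem_span_pair] at hw
  obtain ⟨a, b, rfl⟩ := hw
  simp [hfz, hfv, hkz, hkv]

/-- Let `z` be a non-smooth unit vector of a strictly convex
normed plane with support set the segment `[f, g]`, `f ≠ g`, and let `(z_n)` be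
smooth unit vectors converging to `z`. Then the support functionals `φ(z_n)` have
a convergent subsequence, any limit is `f` or `g`, and the limit is `f`
(resp. `g`) if `(f−g)(z_n) > 0` (resp. `< 0`) eventually. -/
theorem support_functional_limits_at_nonsmooth_point
    (X : Type*) [NormedAddCommGroup X] [NormedSpace ℝ X]
    (hdim : Module.finrank ℝ X = 2)
    (hsc : ∀ x y : X, x ≠ y → ‖x‖ = 1 → ‖y‖ = 1 →
      ∀ t : ℝ, 0 < t → t < 1 → ‖t • x + (1 - t) • y‖ < 1)
    (z : X) (hz1 : ‖z‖ = 1) (hzn : ¬ DifferentiableAt ℝ (fun x : X => ‖x‖) z)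
    (f g : X →L[ℝ] ℝ) (hfg : f ≠ g)
    (hsupp : {h : X →L[ℝ] ℝ | ‖h‖ = ‖z‖ ∧ h z = ‖z‖ ^ 2} = segment ℝ f g)
    (zs : ℕ → X) (hzs1 : ∀ n, ‖zs n‖ = 1)
    (hzsd : ∀ n, DifferentiableAt ℝ (fun x : X => ‖x‖) (zs n))
    (hzslim : Tendsto zs atTop (nhds z)) :
    (∃ k : ℕ → ℕ, StrictMono k ∧ ∃ h : X →L[ℝ] ℝ,
      Tendsto (fun i => ‖zs (k i)‖ • fderiv ℝ (fun x : X => ‖x‖) (zs (k i)))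
        atTop (nhds h)) ∧
    (∀ h : X →L[ℝ] ℝ,
      Tendsto (fun n => ‖zs n‖ • fderiv ℝ (fun x : X => ‖x‖) (zs n))
        atTop (nhds h) → h = f ∨ h = g) ∧
    (∀ h : X →L[ℝ] ℝ,
      Tendsto (fun n => ‖zs n‖ • fderiv ℝ (fun x : X => ‖x‖) (zs n))
        atTop (nhds h) → (∀ᶠ n in atTop, 0 < (f - g) (zs n)) → h = f) ∧
    (∀ h : X →L[ℝ] ℝ,
      Tendsto (fun n => ‖zs n‖ • fderiv ℝ (fun x : X => ‖x‖) (zs n))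
        atTop (nhds h) → (∀ᶠ n in atTop, (f - g) (zs n) < 0) → h = g) := by
  have hfin : FiniteDimensional ℝ X := Module.finite_of_finrank_pos (by omega)
  have hnt : Nontrivial X := Module.nontrivial_of_finrank_pos (R := ℝ) (by omega)
  set φ : ℕ → X →L[ℝ] ℝ := fun n => ‖zs n‖ • fderiv ℝ (fun x : X => ‖x‖) (zs n) with hφdef
  have hφ1 : ∀ n, ‖φ n‖ = 1 := fun n => by
    simp [hφdef, hzs1 n, norm_fderiv_norm (hzsd n)]
  have hφ : ∀ n, φ n (zs n) = 1 := fun n => by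
    simp [hφdef, hzs1 n, (hzsd n).fderiv_norm_self]
  rw [hz1, one_pow] at hsupp
  obtain ⟨hf, hfz⟩ : ‖f‖ = 1 ∧ f z = 1 := hsupp.ge (left_mem_segment ℝ f g)
  obtain ⟨hg, hgz⟩ : ‖g‖ = 1 ∧ g z = 1 := hsupp.ge (right_mem_segment ℝ f g)
  obtain ⟨v, hv, hrep⟩ := exists_dual_vector_of_ne hdim (f := f) (k := f - g) hfz
    (by simp [hfz, hgz]) (sub_ne_zero.2 hfg)
  obtain ⟨v', hv', hrep'⟩ := exists_dual_vector_of_ne hdim (f := g) (k := g - f) hgz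
    (by simp [hfz, hgz]) (sub_ne_zero.2 hfg.symm)
  have hmem : ∀ h, Tendsto φ atTop (nhds h) → h ∈ segment ℝ f g := by
    intro h hlim
    rw [← hsupp]
    refine ⟨tendsto_nhds_unique hlim.norm (by simp [hφ1]), ?_⟩
    have h1 : Tendsto (fun n => φ n (zs n)) atTop (nhds (h z)) :=
      (isBoundedBilinearMap_apply.continuous.tendsto (h, z)).comp (hlim.prodMk_nhds hzslim)
    exact tendsto_nhds_unique h1 (by simp [hφ])
  have hpos : ∀ h, Tendsto φ atTop (nhds h) → (∃ᶠ n in atTop, 0 < (f - g) (zs n)) → h = f := by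
    intro h hlim hfr
    obtain ⟨a, b, ha, hb, hab, rfl⟩ := hmem h hlim
    refine support_functional_limit_eq_of_frequently_pos (b := b) hz1 hfz hf hv hrep ?_ hb hzs1 hzslim
      hφ1 hφ hlim hfr
    obtain rfl : a = 1 - b := by linarith
    module
  have hneg : ∀ h, Tendsto φ atTop (nhds h) → (∃ᶠ n in atTop, (f - g) (zs n) < 0) → h = g := by
    intro h hlim hfr
    obtain ⟨a, b, ha, hb, hab, rfl⟩ := hmem h hlim
    refine support_functional_limit_eq_of_frequently_pos (b := a) hz1 hgz hg hv' hrep' ?_ ha hzs1 hzslim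
      hφ1 hφ hlim (hfr.mono fun n hn => ?_)
    · obtain rfl : b = 1 - a := by linarith
      module
    · simp only [sub_apply] at hn ⊢
      linarith
  have hne : ∀ᶠ n in atTop, (f - g) (zs n) ≠ 0 := by
    have hlim := (f.continuous.tendsto z).comp hzslim
    rw [hfz] at hlim
    filter_upwards [hlim.eventually (lt_mem_nhds one_pos)] with n hn h0
    rw [Function.comp_apply] at hn
    have h1 := hrep (zs n)
    rw [h0, zero_smul, add_zero] at h1
    have h2 := congrArg norm h1
    rw [norm_smul, hz1, hzs1 n, mul_one, Real.norm_of_nonneg hn.le] at h2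
    rw [← h2, one_smul] at h1
    exact hzn (h1 ▸ hzsd n)
  refine ⟨?_, fun h hlim => ?_, fun h hlim hev => hpos h hlim hev.frequently,
    fun h hlim hev => hneg h hlim hev.frequently⟩
  · obtain ⟨h, -, k, hk, hlim⟩ := tendsto_subseq_of_bounded
      (Metric.isBounded_closedBall (x := (0 : X →L[ℝ] ℝ)) (r := 1)) (x := φ)
      (fun n => by simp [hφ1 n])
    exact ⟨k, hk, h, hlim⟩
  · have : ∃ᶠ n in atTop, 0 < (f - g) (zs n) ∨ (f - g) (zs n) < 0 :=
      (hne.mono fun n hn => hn.lt_or_gt.symm).frequently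
    exact (frequently_or_distrib.1 this).imp (hpos h hlim) (hneg h hlim)
end

section
/- Let X be a strictly convex two-dimensional real normed space, let x, y ∈ X be distinct, let r_x, r_y > 0, and suppose S := {z ∈ X : ‖z − x‖ = r_x and ‖z − y‖ = r_y} is nonempty. Then either S = {z} is a singleton and x, y, z are collinear, or S = {z₁, z₂} has exactly two elements; in the latter case, if x and y are linearly independent and L ∈ X* is the (unique) linear functional with L(x) = L(y) = 1, then after relabelling L(z₁) < 1 < L(z₂), i.e. z₁ and z₂ lie on opposite sides of the affine line through x and y. -/
section StrictConvex

variable {E : Type*} [NormedAddCommGroup E] [NormedSpace ℝ E] [StrictConvexSpace ℝ E]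

/-- In a strictly convex space, a point on the line through `0` and `d` is determined by its
distances to `0` and `d`. -/
theorem eq_of_norm_eq_of_norm_sub_eq_of_eq_smul {d v w : E} (hd : d ≠ 0) {a : ℝ}
    (hv : v = a • d) (h₀ : ‖v‖ = ‖w‖) (h₁ : ‖v - d‖ = ‖w - d‖) : v = w := by
  rcases le_total 0 a with ha | ha
  · have hvd : SameRay ℝ v d := hv ▸ SameRay.sameRay_nonneg_smul_left d ha
    have hwd : SameRay ℝ w d := by
      rw [sameRay_iff_norm_sub, ← h₀, ← h₁, hvd.norm_sub]
    exact (sameRay_iff_of_norm_eq h₀).1 (hvd.trans hwd.symm fun h => absurd h hd)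
  · have hvd : SameRay ℝ v (-d) := by
      rw [hv, ← neg_smul_neg]
      exact SameRay.sameRay_nonneg_smul_left (-d) (neg_nonneg.2 ha)
    have hwd : SameRay ℝ w (-d) := by
      rw [sameRay_iff_norm_add, ← h₀, ← sub_eq_add_neg, ← h₁, sub_eq_add_neg, hvd.norm_add]
    exact (sameRay_iff_of_norm_eq h₀).1
      (hvd.trans hwd.symm fun h => absurd (neg_eq_zero.1 h) hd)

/-- In a strictly convex space, two points equidistant from `0` and from `d` coincide as soon as
one of them lies in the cone spanned by `d` and the other. -/
theorem eq_of_norm_eq_of_norm_sub_eq_of_mem_cone {d v w : E} {a b : ℝ} (ha : 0 ≤ a) (hb : 0 ≤ b)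
    (hv : v = a • d + b • w) (h₀ : ‖v‖ = ‖w‖) (h₁ : ‖v - d‖ = ‖w - d‖) : v = w := by
  by_cases hv0 : v = 0
  · rw [hv0, norm_zero] at h₀
    rw [hv0, norm_eq_zero.1 h₀.symm]
  have hs : 0 < a + b := by
    refine lt_of_le_of_ne (add_nonneg ha hb) fun h => hv0 ?_
    rw [hv, show a = 0 by linarith, show b = 0 by linarith]
    simp
  obtain ⟨p, hp⟩ : ∃ p, p = (a + b)⁻¹ • v := ⟨_, rfl⟩
  have hvp : v = (a + b) • p := by rw [hp, smul_inv_smul₀ hs.ne']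
  have hp0 : p ≠ 0 := by
    rintro rfl
    exact hv0 (by rw [hvp, smul_zero])
  have hrayv : SameRay ℝ v p := by
    rw [hvp]
    exact SameRay.sameRay_nonneg_smul_left p hs.le
  have hpd : p - d = (b / (a + b)) • (w - d) := by
    rw [hp, hv]
    match_scalars <;> field_simp
    ring
  have hwp : w - p = (a / (a + b)) • (w - d) := by
    rw [hp, hv]
    match_scalars <;> field_simp
    ring
  have hseg : ‖w - d‖ = ‖w - p‖ + ‖p - d‖ := by
    rw [hpd, hwp, norm_smul, norm_smul, Real.norm_of_nonneg (by positivity),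
      Real.norm_of_nonneg (by positivity)]
    field_simp
  suffices hrayw : SameRay ℝ w p from
    (sameRay_iff_of_norm_eq h₀).1 (hrayv.trans hrayw.symm fun h => absurd h hp0)
  rcases le_total 1 (a + b) with h1 | h1
  · have hv' : ‖v‖ = ‖p‖ + ‖v - p‖ := by
      have : v - p = (a + b - 1) • p := by rw [hvp]; module
      rw [this, hvp, norm_smul, norm_smul, Real.norm_of_nonneg hs.le,
        Real.norm_of_nonneg (by linarith)]
      ring
    have h2 : ‖v - d‖ ≤ ‖v - p‖ + ‖p - d‖ := norm_sub_le_norm_sub_add_norm_sub v p d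
    have h3 : ‖p + (w - p)‖ ≤ ‖p‖ + ‖w - p‖ := norm_add_le _ _
    have h4 : SameRay ℝ p (w - p) := by
      rw [sameRay_iff_norm_add]
      rw [add_sub_cancel] at h3 ⊢
      linarith
    simpa using ((SameRay.refl p).add_right h4).symm
  · have hp' : ‖p‖ = ‖v‖ + ‖v - p‖ := by
      have : v - p = -((1 - (a + b)) • p) := by rw [hvp]; module
      rw [this, norm_neg, hvp, norm_smul, norm_smul, Real.norm_of_nonneg hs.le,
        Real.norm_of_nonneg (by linarith)]
      ring
    have h2 : ‖v - d‖ ≤ ‖v - p‖ + ‖p - d‖ := norm_sub_le_norm_sub_add_norm_sub v p d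
    have h3 : ‖w + (p - w)‖ ≤ ‖w‖ + ‖p - w‖ := norm_add_le _ _
    have h4 : SameRay ℝ w (p - w) := by
      rw [sameRay_iff_norm_add]
      rw [add_sub_cancel] at h3 ⊢
      rw [norm_sub_rev p w] at h3 ⊢
      linarith
    simpa using (SameRay.refl w).add_right h4

/-- In a strictly convex space, two points equidistant from `0` and from `d` coincide if they lie
in the same open half-plane bounded by the line through `0` and `d`. -/
theorem eq_of_norm_eq_of_norm_sub_eq_of_same_side {d v w : E} {a b : ℝ} (hb : 0 < b)
    (hv : v = a • d + b • w) (h₀ : ‖v‖ = ‖w‖) (h₁ : ‖v - d‖ = ‖w - d‖) : v = w := by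
  rcases le_total 0 a with ha | ha
  · exact eq_of_norm_eq_of_norm_sub_eq_of_mem_cone ha hb.le hv h₀ h₁
  · refine (eq_of_norm_eq_of_norm_sub_eq_of_mem_cone (a := -a / b) (b := b⁻¹)
      (div_nonneg (neg_nonneg.2 ha) hb.le) (inv_nonneg.2 hb.le) ?_ h₀.symm h₁.symm).symm
    rw [hv]
    match_scalars <;> field_simp
    ring

end StrictConvex

/-- If some point has distances `‖w‖` and `‖w - d‖` to `0` and `d`, then so does a point of the
closed half-plane bounded by the line through `0` and `d` that does not contain `w`. -/
theorem exists_norm_eq_norm_sub_eq_opposite_side {E : Type*} [NormedAddCommGroup E]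
    [NormedSpace ℝ E] {d w : E} (h : LinearIndependent ℝ ![d, w]) :
    ∃ a t : ℝ, 0 ≤ t ∧ ‖a • d - t • w‖ = ‖w‖ ∧ ‖a • d - t • w - d‖ = ‖w - d‖ := by
  have hd : 0 < ‖d‖ := norm_pos_iff.2 (h.ne_zero 0)
  have hγ : ∀ θ : ℝ, ‖Real.cos θ • d - Real.sin θ • w‖ ≠ 0 := by
    intro θ hθ
    have h' := LinearIndependent.pair_iff.1 h (Real.cos θ) (-Real.sin θ)
      (by rw [neg_smul, ← sub_eq_add_neg]; exact norm_eq_zero.1 hθ)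
    have := Real.sin_sq_add_cos_sq θ
    rw [h'.1, neg_eq_zero.1 h'.2] at this
    norm_num at this
  let g : ℝ → E := fun θ => (‖w‖ / ‖Real.cos θ • d - Real.sin θ • w‖) •
    (Real.cos θ • d - Real.sin θ • w)
  have hg : Continuous g := by
    have : Continuous fun θ : ℝ => Real.cos θ • d - Real.sin θ • w := by fun_prop
    exact (continuous_const.div this.norm hγ).smul this
  have hg0 : ‖g 0 - d‖ ≤ ‖w - d‖ := by
    have : g 0 - d = ((‖w‖ - ‖d‖) / ‖d‖) • d := by
      simp only [g, Real.cos_zero, Real.sin_zero, one_smul, zero_smul, sub_zero]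
      match_scalars
      field_simp
    rw [this, norm_smul, norm_div, norm_norm, div_mul_cancel₀ _ hd.ne']
    exact abs_norm_sub_norm_le w d
  have hgπ : ‖w - d‖ ≤ ‖g Real.pi - d‖ := by
    have : g Real.pi - d = -(((‖w‖ + ‖d‖) / ‖d‖) • d) := by
      simp only [g, Real.cos_pi, Real.sin_pi, zero_smul, sub_zero, neg_smul, one_smul, norm_neg]
      match_scalars
      field_simp
      ring
    rw [this, norm_neg, norm_smul, Real.norm_of_nonneg (by positivity), div_mul_cancel₀ _ hd.ne']
    exact norm_sub_le w d
  obtain ⟨θ, hθ, hθ'⟩ := intermediate_value_Icc Real.pi_pos.le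
    (hg.sub continuous_const).norm.continuousOn ⟨hg0, hgπ⟩
  have hgθ : g θ = (‖w‖ / ‖Real.cos θ • d - Real.sin θ • w‖ * Real.cos θ) • d -
      (‖w‖ / ‖Real.cos θ • d - Real.sin θ • w‖ * Real.sin θ) • w := by
    simp only [g, smul_sub, mul_smul]
  refine ⟨‖w‖ / ‖Real.cos θ • d - Real.sin θ • w‖ * Real.cos θ,
    ‖w‖ / ‖Real.cos θ • d - Real.sin θ • w‖ * Real.sin θ,
    mul_nonneg (by positivity) (Real.sin_nonneg_of_mem_Icc hθ), ?_, ?_⟩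
  · rw [← hgθ]
    simp only [g]
    rw [norm_smul, norm_div, norm_norm, norm_norm, div_mul_cancel₀ _ (hγ θ)]
  · rw [← hgθ]
    exact hθ'


/-- In a strictly convex normed plane, two circles that meet do
so either in a single point collinear with the two centres, or in exactly two
points lying on opposite sides of the line through the centres. -/
theorem circles_intersection_structure
    (X : Type*) [NormedAddCommGroup X] [NormedSpace ℝ X]
    (hdim : Module.finrank ℝ X = 2)
    (hsc : ∀ x y : X, x ≠ y → ‖x‖ = 1 → ‖y‖ = 1 →
      ∀ t : ℝ, 0 < t → t < 1 → ‖t • x + (1 - t) • y‖ < 1)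
    (x y : X) (hxy : x ≠ y) (rx ry : ℝ) (hrx : 0 < rx) (hry : 0 < ry)
    (hne : {z : X | ‖z - x‖ = rx ∧ ‖z - y‖ = ry}.Nonempty) :
    (∃ z : X, {z' : X | ‖z' - x‖ = rx ∧ ‖z' - y‖ = ry} = {z} ∧
      Collinear ℝ ({x, y, z} : Set X)) ∨
    (∃ z₁ z₂ : X, z₁ ≠ z₂ ∧
      {z' : X | ‖z' - x‖ = rx ∧ ‖z' - y‖ = ry} = {z₁, z₂} ∧
      (LinearIndependent ℝ ![x, y] →
        ∀ L : X →L[ℝ] ℝ, L x = 1 → L y = 1 →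
          (L z₁ < 1 ∧ 1 < L z₂) ∨ (L z₂ < 1 ∧ 1 < L z₁))) := by
  have : StrictConvexSpace ℝ X := StrictConvexSpace.of_norm_combo_lt_one fun u v hu hv huv =>
    ⟨1 / 2, 1 - 1 / 2, by norm_num, hsc u v huv hu hv (1 / 2) (by norm_num) (by norm_num)⟩
  obtain ⟨z, hzx, hzy⟩ := hne
  obtain ⟨d, hd⟩ : ∃ d, d = y - x := ⟨_, rfl⟩
  obtain ⟨w, hw⟩ : ∃ w, w = z - x := ⟨_, rfl⟩
  have hd0 : d ≠ 0 := hd ▸ sub_ne_zero.2 hxy.symm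
  have hmem : ∀ p : X, (‖p - x‖ = rx ∧ ‖p - y‖ = ry) ↔
      (‖p - x‖ = ‖w‖ ∧ ‖p - x - d‖ = ‖w - d‖) := by
    intro p
    rw [hw, hd, sub_sub_sub_cancel_right, sub_sub_sub_cancel_right, hzx, hzy]
  by_cases hli : LinearIndependent ℝ ![d, w]
  · right
    obtain ⟨a, t, ht, h₀, h₁⟩ := exists_norm_eq_norm_sub_eq_opposite_side hli
    have hw_not : ∀ c : ℝ, c • d ≠ w := (LinearIndependent.pair_iff' hd0).1 hli
    have ht0 : 0 < t := by
      refine lt_of_le_of_ne ht fun h => hw_not a ?_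
      rw [← h, zero_smul, sub_zero] at h₀ h₁
      exact eq_of_norm_eq_of_norm_sub_eq_of_eq_smul hd0 rfl h₀ h₁
    have hspan : ∀ v : X, ∃ b c : ℝ, v = b • d + c • w := by
      intro v
      let B := basisOfLinearIndependentOfCardEqFinrank hli (by simp [hdim])
      refine ⟨B.repr v 0, B.repr v 1, ?_⟩
      have := B.sum_repr v
      simpa [B, Fin.sum_univ_two] using this.symm
    refine ⟨z, x + (a • d - t • w), ?_, ?_, ?_⟩
    · intro h
      have h' : (-a) • d + (1 + t) • w = 0 := by
        have hwz : w = a • d - t • w := by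
          nth_rewrite 1 [hw]
          exact sub_eq_iff_eq_add'.2 h
        rw [← sub_eq_zero.2 hwz]
        module
      have := (LinearIndependent.pair_iff.1 hli _ _ h').2
      linarith
    · ext p
      simp only [Set.mem_ofPred_eq, Set.mem_insert_iff, Set.mem_singleton_iff]
      rw [hmem]
      constructor
      · rintro ⟨hp₀, hp₁⟩
        obtain ⟨b, c, hp⟩ := hspan (p - x)
        rcases lt_trichotomy c 0 with hc | hc | hc
        · right
          rw [← sub_eq_iff_eq_add']
          refine eq_of_norm_eq_of_norm_sub_eq_of_same_side (d := d) (a := b + c * a / t)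
            (b := -c / t) (div_pos (neg_pos.2 hc) ht0) ?_ (hp₀.trans h₀.symm) (hp₁.trans h₁.symm)
          rw [hp]
          match_scalars <;> field_simp
          ring
        · rw [hc, zero_smul, add_zero] at hp
          have := eq_of_norm_eq_of_norm_sub_eq_of_eq_smul hd0 hp hp₀ hp₁
          exact absurd (hp.symm.trans this) (hw_not b)
        · left
          have := eq_of_norm_eq_of_norm_sub_eq_of_same_side hc hp hp₀ hp₁
          rw [hw] at this
          exact sub_left_injective this
      · rintro (rfl | rfl)
        · rw [← hw]
          exact ⟨rfl, rfl⟩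
        · rw [add_sub_cancel_left]
          exact ⟨h₀, h₁⟩
    · intro _ L hLx hLy
      have hLd : L d = 0 := by rw [hd, map_sub, hLx, hLy, sub_self]
      have hLw : L w = L z - 1 := by rw [hw, map_sub, hLx]
      have hLz' : L (x + (a • d - t • w)) = 1 - t * L w := by
        simp [hLx, hLd, sub_eq_add_neg]
      have hLw0 : L w ≠ 0 := by
        intro h
        obtain ⟨b, c, hx⟩ := hspan x
        rw [hx] at hLx
        simp [hLd, h] at hLx
      rw [hLz']
      rcases lt_or_gt_of_ne hLw0 with h | h
      · left
        have := mul_neg_of_pos_of_neg ht0 h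
        constructor <;> linarith
      · right
        have := mul_pos ht0 h
        constructor <;> linarith
  · left
    rw [LinearIndependent.pair_iff' hd0] at hli
    push Not at hli
    obtain ⟨a, ha⟩ := hli
    refine ⟨z, ?_, ?_⟩
    · ext p
      simp only [Set.mem_ofPred_eq, Set.mem_singleton_iff]
      rw [hmem]
      constructor
      · rintro ⟨hp₀, hp₁⟩
        have := eq_of_norm_eq_of_norm_sub_eq_of_eq_smul hd0 ha.symm hp₀.symm hp₁.symm
        rw [hw] at this
        exact (sub_left_injective this).symm
      · rintro rfl
        rw [← hw]
        exact ⟨rfl, rfl⟩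
    · rw [collinear_iff_of_mem (p₀ := x) (by simp)]
      refine ⟨d, ?_⟩
      rintro p (rfl | rfl | rfl)
      · exact ⟨0, by simp⟩
      · exact ⟨1, by simp [hd]⟩
      · exact ⟨a, by rw [ha, hw]; simp⟩
end

section
/- Let X be a strictly convex two-dimensional real normed space and let p, q : {1,2,3,4} → X satisfy ‖q_i − q_j‖ = ‖p_i − p_j‖ for every pair i < j with (i,j) ≠ (1,4) (i.e. for all five edges of K₄ minus the edge {1,4}). If the triple (p₁, p₂, p₃) is affinely independent and the triple (p₂, p₃, p₄) is affinely independent, then the triples (q₁, q₂, q₃) and (q₂, q₃, q₄) are each affinely independent. -/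
/-- In a strictly convex space, collinearity of three points is determined by their mutual
distances. -/
theorem Collinear.of_dist_eq {V P : Type*} [NormedAddCommGroup V] [NormedSpace ℝ V]
    [StrictConvexSpace ℝ V] [MetricSpace P] [NormedAddTorsor V P] {a b c a' b' c' : P}
    (h : Collinear ℝ {a, b, c}) (hab : dist a b = dist a' b') (hbc : dist b c = dist b' c')
    (hac : dist a c = dist a' c') : Collinear ℝ {a', b', c'} := by
  rcases h.wbtw_or_wbtw_or_wbtw with h | h | h
  · refine (dist_add_dist_eq_iff.1 ?_ : Wbtw ℝ a' b' c').collinear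
    rw [← hab, ← hbc, ← hac, h.dist_add_dist]
  · have hw : Wbtw ℝ b' c' a' := dist_add_dist_eq_iff.1 <| by
      rw [← hbc, dist_comm c' a', ← hac, dist_comm b' a', ← hab, dist_comm a c, dist_comm a b,
        h.dist_add_dist]
    exact hw.collinear.subset (by grind)
  · have hw : Wbtw ℝ c' a' b' := dist_add_dist_eq_iff.1 <| by
      rw [dist_comm c' a', ← hac, ← hab, dist_comm c' b', ← hbc, dist_comm a c, dist_comm b c,
        h.dist_add_dist]
    exact hw.collinear.subset (by grind)

/-- In a strictly convex normed plane, any placement `q` of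
`K₄ − e` (the edge `{1,4}`, here `{0,3}` in `Fin 4`, removed) with the same edge
lengths as a placement `p` whose 3-cycles are affinely independent also has
affinely independent 3-cycles. -/
theorem equivalent_placements_three_cycle_general_position
    (X : Type*) [NormedAddCommGroup X] [NormedSpace ℝ X]
    (hdim : Module.finrank ℝ X = 2)
    (hsc : ∀ x y : X, x ≠ y → ‖x‖ = 1 → ‖y‖ = 1 →
      ∀ t : ℝ, 0 < t → t < 1 → ‖t • x + (1 - t) • y‖ < 1)
    (p q : Fin 4 → X)
    (hdist : ∀ i j : Fin 4, i < j → (i, j) ≠ ((0 : Fin 4), (3 : Fin 4)) →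
      ‖q i - q j‖ = ‖p i - p j‖)
    (h123 : AffineIndependent ℝ ![p 0, p 1, p 2])
    (h234 : AffineIndependent ℝ ![p 1, p 2, p 3]) :
    AffineIndependent ℝ ![q 0, q 1, q 2] ∧
    AffineIndependent ℝ ![q 1, q 2, q 3] := by
  have : StrictConvexSpace ℝ X := StrictConvexSpace.of_norm_combo_lt_one fun x y hx hy hxy =>
    ⟨1 / 2, 1 - 1 / 2, by norm_num, hsc x y hxy hx hy (1 / 2) (by norm_num) (by norm_num)⟩
  have hd (i j : Fin 4) (hij : i < j) (hne : (i, j) ≠ (0, 3)) :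
      dist (q i) (q j) = dist (p i) (p j) := by
    simpa only [dist_eq_norm] using hdist i j hij hne
  rw [affineIndependent_iff_not_collinear_set] at h123 h234 ⊢
  rw [affineIndependent_iff_not_collinear_set]
  exact ⟨fun h => h123 <| h.of_dist_eq (hd 0 1 (by decide) (by decide))
      (hd 1 2 (by decide) (by decide)) (hd 0 2 (by decide) (by decide)),
    fun h => h234 <| h.of_dist_eq (hd 1 2 (by decide) (by decide))
      (hd 2 3 (by decide) (by decide)) (hd 1 3 (by decide) (by decide))⟩
end

section
/- Let X be a two-dimensional real normed space, let G be a finite simple graph with at least two vertices, let v₁ ≠ v₂ be vertices of G, and let G' be the 0-extension of G at v₁, v₂: the graph obtained from G by adding one new vertex v₀ together with the two edges v₀v₁ and v₀v₂. Then G' is independent in X if and only if G is independent in X. -/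
/-- A placement `p` of a graph `G` in a normed space is *well-positioned* if the
norm is Fréchet differentiable at `p v - p w` for every edge `vw`. -/
def IsWellPositioned {X : Type*} [NormedAddCommGroup X] [NormedSpace ℝ X]
    {V : Type*} (G : SimpleGraph V) (p : V → X) : Prop :=
  ∀ v w : V, G.Adj v w → DifferentiableAt ℝ (fun x : X => ‖x‖) (p v - p w)

/-- A graph `G` is *independent* in a normed space `X` if it admits a
well-positioned placement whose rigidity operator is surjective. -/
def IsIndependentIn (X : Type*) [NormedAddCommGroup X] [NormedSpace ℝ X]
    {V : Type*} (G : SimpleGraph V) : Prop :=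
  ∃ p : V → X, IsWellPositioned G p ∧
    ∀ m : G.edgeSet → ℝ, ∃ u : V → X, ∀ (v w : V) (h : G.Adj v w),
      fderiv ℝ (fun x : X => ‖x‖) (p v - p w) (u v - u w)
        = m ⟨s(v, w), (G.mem_edgeSet).mpr h⟩

section NormDerivative

variable {X : Type*} [NormedAddCommGroup X] [NormedSpace ℝ X]

theorem differentiableAt_norm_neg {x : X} (h : DifferentiableAt ℝ (fun x : X => ‖x‖) x) :
    DifferentiableAt ℝ (fun x : X => ‖x‖) (-x) := by
  have h' : DifferentiableAt ℝ (fun x : X => ‖x‖) (- -x) := by rwa [neg_neg]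
  simpa [Function.comp_def] using h'.comp (-x) differentiableAt_id.neg

theorem fderiv_norm_neg (x : X) :
    fderiv ℝ (fun x : X => ‖x‖) (-x) = -fderiv ℝ (fun x : X => ‖x‖) x := by
  simpa using fderiv_norm_smul (E := X) (x := x) (t := -1)

theorem fderiv_norm_sub_comm (a b c d : X) :
    fderiv ℝ (fun x : X => ‖x‖) (a - b) (c - d) =
      fderiv ℝ (fun x : X => ‖x‖) (b - a) (d - c) := by
  rw [← neg_sub b a, fderiv_norm_neg, ← neg_sub d c]
  simp

theorem fderiv_norm_apply_le (x y : X) : fderiv ℝ (fun x : X => ‖x‖) x y ≤ ‖y‖ := by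
  have h1 := (fderiv ℝ (fun x : X => ‖x‖) x).le_of_opNorm_le
    (norm_fderiv_le_of_lipschitz ℝ lipschitzWith_one_norm) y
  rw [NNReal.coe_one, one_mul] at h1
  exact (le_abs_self _).trans h1

theorem tendsto_fderiv_norm_apply {ι : Type*} {l : Filter ι} {f : ι → X} {x : X}
    (hf : Filter.Tendsto f l (nhds x)) (hl : ∀ᶠ i in l, DifferentiableAt ℝ (fun x : X => ‖x‖) (f i))
    (hx : DifferentiableAt ℝ (fun x : X => ‖x‖) x) (u : X) :
    Filter.Tendsto (fun i => fderiv ℝ (fun x : X => ‖x‖) (f i) u) l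
      (nhds (fderiv ℝ (fun x : X => ‖x‖) x u)) := by
  have upper : ∀ u : X, ∀ r, fderiv ℝ (fun x : X => ‖x‖) x u < r →
      ∀ᶠ i in l, fderiv ℝ (fun x : X => ‖x‖) (f i) u < r := by
    intro u r hr
    have hline : HasDerivAt (fun t : ℝ => ‖x + t • u‖) (fderiv ℝ (fun x : X => ‖x‖) x u) 0 := by
      have := hx.hasFDerivAt.hasLineDerivAt u
      simpa [HasLineDerivAt] using this
    have hslope := (hasDerivAt_iff_tendsto_slope_zero.1 hline).eventually_lt_const hr
    obtain ⟨t, ht, ht0⟩ := ((hslope.filter_mono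
      (nhdsWithin_mono (0 : ℝ) (s := Set.Ioi 0) (fun t ht => (Set.mem_Ioi.1 ht).ne'))).and
        self_mem_nhdsWithin).exists
    have ht0' : (0 : ℝ) < t := ht0
    simp only [zero_add, zero_smul, add_zero, smul_eq_mul] at ht
    have hcont : Filter.Tendsto (fun i => t⁻¹ * (‖f i + t • u‖ - ‖f i‖)) l
        (nhds (t⁻¹ * (‖x + t • u‖ - ‖x‖))) :=
      ((hf.add_const _).norm.sub hf.norm).const_mul _
    filter_upwards [hcont.eventually_lt_const ht, hl] with i hi hd
    refine lt_of_le_of_lt ?_ hi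
    have h1 := fderiv_norm_apply_le (f i) (f i + t • u)
    rw [map_add, map_smul, hd.fderiv_norm_self, smul_eq_mul] at h1
    rw [le_inv_mul_iff₀ ht0']
    linarith
  rw [tendsto_order]
  refine ⟨fun r hr => ?_, upper u⟩
  filter_upwards [upper (-u) (-r) (by simpa using hr)] with i hi
  simpa using hi

theorem dense_differentiableAt_norm_add [FiniteDimensional ℝ X] {ι : Type*} [Countable ι]
    (a : ι → X) : Dense {x | ∀ i, DifferentiableAt ℝ (fun x : X => ‖x‖) (x + a i)} := by
  let : MeasurableSpace X := borel X
  have : BorelSpace X := ⟨rfl⟩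
  refine MeasureTheory.Measure.dense_of_ae (μ := MeasureTheory.Measure.addHaar) ?_
  rw [MeasureTheory.ae_all_iff]
  intro i
  exact (MeasureTheory.measurePreserving_add_right _ (a i)).quasiMeasurePreserving.ae
    (lipschitzWith_one_norm.ae_differentiableAt)

/-- The norm is not midpoint-affine on all translates of a segment `[0, z]` starting outside the
ball of radius `‖z‖`: otherwise it would be affine on the half-integer points of a line avoiding
that ball, although it is unbounded in both directions. -/
theorem exists_norm_add_half_ne [FiniteDimensional ℝ X] (hdim : Module.finrank ℝ X = 2)
    {z : X} (hz : z ≠ 0) :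
    ∃ x : X, ‖z‖ < ‖x‖ ∧ ‖x‖ + ‖x + z‖ ≠ 2 * ‖x + (2⁻¹ : ℝ) • z‖ := by
  by_contra! H
  obtain ⟨w, hw⟩ : ∃ w : X, w ∉ Submodule.span ℝ {z} := by
    by_contra! h
    have h1 : Submodule.span ℝ {z} = ⊤ := Submodule.eq_top_iff'.2 h
    have h2 := finrank_span_singleton (K := ℝ) hz
    rw [h1, finrank_top, hdim] at h2
    omega
  obtain ⟨h, hw1, hz0⟩ := Submodule.exists_le_ker_of_notMem hw
  have hz0 : h z = 0 := hz0 (Submodule.mem_span_singleton_self z)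
  let g : X →L[ℝ] ℝ := LinearMap.toContinuousLinearMap h
  have hg : ∀ y, |h y| ≤ ‖g‖ * ‖y‖ := fun y => g.le_opNorm y
  set x : X := ((‖g‖ * (‖z‖ + 1)) / h w) • w with hx
  have hhx : h x = ‖g‖ * (‖z‖ + 1) := by
    rw [hx, map_smul, smul_eq_mul, div_mul_cancel₀ _ hw1]
  have hg0 : 0 < ‖g‖ := by
    rw [norm_pos_iff]
    intro h0
    apply hw1
    have : g w = 0 := by rw [h0]; rfl
    exact this
  have hfar : ∀ s : ℝ, ‖z‖ < ‖x + s • z‖ := by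
    intro s
    have h1 := hg (x + s • z)
    rw [map_add, hhx, map_smul, hz0, smul_zero, add_zero] at h1
    have h2 := (le_abs_self _).trans h1
    have := le_of_mul_le_mul_left h2 hg0
    linarith
  have hrec : ∀ s : ℝ, ‖x + s • z‖ + ‖x + (s + 1) • z‖ = 2 * ‖x + (s + 2⁻¹) • z‖ := by
    intro s
    have := H _ (hfar s)
    rwa [add_assoc, add_assoc, ← add_smul, ← add_assoc,
      show x + s • z + z = x + (s + 1) • z by rw [add_smul, one_smul, add_assoc]] at this
  have harith : ∀ (s : ℝ) (n : ℕ),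
      ‖x + (s + n * 2⁻¹) • z‖ = ‖x + s • z‖ + n * (‖x + (s + 2⁻¹) • z‖ - ‖x + s • z‖) := by
    intro s n
    induction n using Nat.twoStepInduction with
    | zero => simp
    | one => simp
    | more n h₀ h₁ =>
      have h₂ := hrec (s + n * 2⁻¹)
      rw [show s + n * 2⁻¹ + 1 = s + ((n + 2 : ℕ) : ℝ) * 2⁻¹ by push_cast; ring,
        show s + n * 2⁻¹ + 2⁻¹ = s + ((n + 1 : ℕ) : ℝ) * 2⁻¹ by push_cast; ring, h₀, h₁] at h₂
      push_cast at h₂ ⊢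
      linarith
  have hbound : ∀ n : ℕ, n * ‖z‖ ≤ 2 * ‖x‖ := by
    intro n
    have h₁ := harith (-(n * 2⁻¹)) n
    have h₂ := harith (-(n * 2⁻¹)) (2 * n)
    rw [neg_add_cancel, zero_smul, add_zero] at h₁
    rw [show -(n * 2⁻¹ : ℝ) + ((2 * n : ℕ) : ℝ) * 2⁻¹ = n * 2⁻¹ by push_cast; ring] at h₂
    have h₃ := norm_sub_le (x + (n * 2⁻¹ : ℝ) • z) (x + (-(n * 2⁻¹ : ℝ)) • z)
    rw [add_sub_add_left_eq_sub, ← sub_smul, norm_smul,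
      show (n * 2⁻¹ - -(n * 2⁻¹) : ℝ) = n by ring, Real.norm_natCast] at h₃
    push_cast at h₂
    linarith
  obtain ⟨n, hn⟩ := exists_nat_gt (2 * ‖x‖ / ‖z‖)
  rw [div_lt_iff₀ (norm_pos_iff.2 hz)] at hn
  exact (hbound n).not_gt hn

theorem exists_fderiv_norm_ne [FiniteDimensional ℝ X] (hdim : Module.finrank ℝ X = 2)
    {z : X} (hz : z ≠ 0) :
    ∃ x : X, DifferentiableAt ℝ (fun x : X => ‖x‖) x ∧
      DifferentiableAt ℝ (fun x : X => ‖x‖) (x + z) ∧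
      ∀ c : ℝ, fderiv ℝ (fun x : X => ‖x‖) x ≠ c • fderiv ℝ (fun x : X => ‖x‖) (x + z) := by
  obtain ⟨y, hy, hyz⟩ := exists_norm_add_half_ne hdim hz
  have hopen : IsOpen {x : X | ‖z‖ < ‖x‖ ∧ ‖x‖ + ‖x + z‖ ≠ 2 * ‖x + (2⁻¹ : ℝ) • z‖} :=
    (isOpen_lt continuous_const continuous_norm).inter (isOpen_ne_fun
      (f := fun x : X => ‖x‖ + ‖x + z‖) (g := fun x : X => 2 * ‖x + (2⁻¹ : ℝ) • z‖)
      (by fun_prop) (by fun_prop))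
  obtain ⟨x, ⟨hx, hxz⟩, hd⟩ := (dense_differentiableAt_norm_add ![0, z]).inter_open_nonempty _
    hopen ⟨y, hy, hyz⟩
  have h₀ : DifferentiableAt ℝ (fun x : X => ‖x‖) x := by simpa using hd 0
  have h₁ : DifferentiableAt ℝ (fun x : X => ‖x‖) (x + z) := by simpa using hd 1
  refine ⟨x, h₀, h₁, fun c hc => hxz ?_⟩
  have : Nontrivial X := ⟨z, 0, hz⟩
  have hself₀ := h₀.fderiv_norm_self
  have hself₁ := h₁.fderiv_norm_self
  have hnorm := congrArg norm hc
  rw [norm_smul, norm_fderiv_norm h₀, norm_fderiv_norm h₁, mul_one, Real.norm_eq_abs] at hnorm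
  rcases (abs_eq zero_le_one).1 hnorm.symm with rfl | rfl
  · rw [one_smul] at hc
    rw [← hc] at hself₁
    have h₂ := fderiv_norm_apply_le x (x + (2⁻¹ : ℝ) • z)
    rw [map_add, map_smul, smul_eq_mul] at h₂
    rw [map_add] at hself₁
    have h₃ := norm_add_le x (x + z)
    rw [show x + (x + z) = (2 : ℝ) • (x + (2⁻¹ : ℝ) • z) by module, norm_smul,
      Real.norm_ofNat] at h₃
    linarith
  · exfalso
    have h₂ := fderiv_norm_apply_le (x + z) z
    have h₃ : fderiv ℝ (fun x : X => ‖x‖) x x = -fderiv ℝ (fun x : X => ‖x‖) (x + z) x := by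
      conv_lhs => rw [hc]
      simp
    rw [map_add] at hself₁
    have := norm_nonneg (x + z)
    linarith

theorem exists_apply_eq_of_forall_ne_smul {f g : X →L[ℝ] ℝ} (hg : g ≠ 0)
    (hfg : ∀ c : ℝ, f ≠ c • g) (a b : ℝ) : ∃ u, f u = a ∧ g u = b := by
  obtain ⟨w, hw⟩ : ∃ w, g w ≠ 0 := by
    by_contra! h
    exact hg (ContinuousLinearMap.ext h)
  obtain ⟨y, hgy, hfy⟩ : ∃ y, g y = 0 ∧ f y ≠ 0 := by
    by_contra! h
    refine hfg (f w / g w) (ContinuousLinearMap.ext fun v => ?_)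
    have := h (v - (g v / g w) • w) (by simp [hw])
    rw [map_sub, map_smul, smul_eq_mul, sub_eq_zero] at this
    rw [this, smul_apply, smul_eq_mul]
    ring
  refine ⟨(b / g w) • w + ((a - b / g w * f w) / f y) • y, ?_, ?_⟩
  · simp [hfy]
  · simp [hgy, hw]

end NormDerivative

theorem isIndependentIn_iff_sym2 {X : Type*} [NormedAddCommGroup X] [NormedSpace ℝ X]
    {V : Type*} (G : SimpleGraph V) :
    IsIndependentIn X G ↔ ∃ p : V → X, IsWellPositioned G p ∧
      ∀ m : Sym2 V → ℝ, ∃ u : V → X, ∀ v w, G.Adj v w →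
        fderiv ℝ (fun x : X => ‖x‖) (p v - p w) (u v - u w) = m s(v, w) := by
  classical
  refine exists_congr fun p => and_congr_right fun _ => ⟨fun h m => h fun e => m e, fun h m => ?_⟩
  obtain ⟨u, hu⟩ := h fun e => if he : e ∈ G.edgeSet then m ⟨e, he⟩ else 0
  refine ⟨u, fun v w hvw => ?_⟩
  rw [hu v w hvw, dif_pos]

/-- Surjectivity of the rigidity operator persists along a filter of well-positioned placements
converging to a well-positioned placement. -/
theorem eventually_surjective_of_tendsto {X : Type*} [NormedAddCommGroup X] [NormedSpace ℝ X]
    {V : Type*} [Finite V] {G : SimpleGraph V} {p : V → X} (hp : IsWellPositioned G p)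
    (hsurj : ∀ m : Sym2 V → ℝ, ∃ u : V → X, ∀ v w, G.Adj v w →
      fderiv ℝ (fun x : X => ‖x‖) (p v - p w) (u v - u w) = m s(v, w))
    {ι : Type*} {l : Filter ι} {q : ι → V → X} (hq : Filter.Tendsto q l (nhds p))
    (hwell : ∀ᶠ i in l, IsWellPositioned G (q i)) :
    ∀ᶠ i in l, ∀ m : Sym2 V → ℝ, ∃ u : V → X, ∀ v w, G.Adj v w →
      fderiv ℝ (fun x : X => ‖x‖) (q i v - q i w) (u v - u w) = m s(v, w) := by
  classical
  have := Fintype.ofFinite G.edgeSet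
  have hends : ∀ e : G.edgeSet, ∃ v w, G.Adj v w ∧ (e : Sym2 V) = s(v, w) := by
    rintro ⟨e, he⟩
    induction e with
    | h v w => exact ⟨v, w, he, rfl⟩
  choose a b hab hs using hends
  choose U hU using fun e : G.edgeSet => hsurj fun e' => if e' = e then 1 else 0
  let M : (V → X) → Matrix G.edgeSet G.edgeSet ℝ := fun r => Matrix.of fun e e' =>
    fderiv ℝ (fun x : X => ‖x‖) (r (a e) - r (b e)) (U e' (a e) - U e' (b e))
  have hMp : M p = 1 := by
    ext e e'
    simp only [M, Matrix.of_apply, hU e' _ _ (hab e), ← hs, Matrix.one_apply, Subtype.ext_iff]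
  have hM : Filter.Tendsto (fun i => M (q i)) l (nhds (M p)) := by
    refine tendsto_pi_nhds.2 fun e => tendsto_pi_nhds.2 fun e' => ?_
    rw [tendsto_pi_nhds] at hq
    exact tendsto_fderiv_norm_apply ((hq _).sub (hq _))
      (hwell.mono fun i hi => hi _ _ (hab e)) (hp _ _ (hab e)) _
  have hdet : Filter.Tendsto (fun i => (M (q i)).det) l (nhds (M p).det) :=
    ((continuous_id.matrix_det).tendsto (M p)).comp hM
  rw [hMp, Matrix.det_one] at hdet
  filter_upwards [hdet.eventually_ne one_ne_zero] with i hi m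
  set c := (M (q i))⁻¹.mulVec fun e : G.edgeSet => m e
  have hc : (M (q i)).mulVec c = fun e : G.edgeSet => m e := by
    rw [Matrix.mulVec_mulVec, Matrix.mul_nonsing_inv _ hi.isUnit, Matrix.one_mulVec]
  refine ⟨∑ e, c e • U e, fun v w hvw => ?_⟩
  have hce := congrFun hc ⟨s(v, w), hvw⟩
  set e : G.edgeSet := ⟨s(v, w), hvw⟩
  have key : fderiv ℝ (fun x : X => ‖x‖) (q i (a e) - q i (b e))
      ((∑ e, c e • U e) (a e) - (∑ e, c e • U e) (b e)) = m s(v, w) := by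
    rw [← hce]
    simp only [Finset.sum_apply, Pi.smul_apply, ← Finset.sum_sub_distrib, ← smul_sub, map_sum,
      map_smul, Matrix.mulVec, dotProduct]
    exact Finset.sum_congr rfl fun e' _ => mul_comm _ _
  rcases Sym2.eq_iff.1 (hs e) with ⟨hv, hw⟩ | ⟨hv, hw⟩
  · rwa [← hv, ← hw] at key
  · rwa [← hv, ← hw, fderiv_norm_sub_comm] at key

theorem exists_independent_placement_ne {X : Type*} [NormedAddCommGroup X] [NormedSpace ℝ X]
    [FiniteDimensional ℝ X] [Nontrivial X]
    {V : Type*} [Finite V] {G : SimpleGraph V} (hG : IsIndependentIn X G) {v₁ v₂ : V}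
    (hv : v₁ ≠ v₂) :
    ∃ p : V → X, p v₁ ≠ p v₂ ∧ IsWellPositioned G p ∧
      ∀ m : Sym2 V → ℝ, ∃ u : V → X, ∀ v w, G.Adj v w →
        fderiv ℝ (fun x : X => ‖x‖) (p v - p w) (u v - u w) = m s(v, w) := by
  classical
  obtain ⟨p, hp, hsurj⟩ := (isIndependentIn_iff_sym2 G).1 hG
  let q : X → V → X := fun ε => Function.update p v₁ (ε + p v₁)
  let A : Set X := {ε | ∀ w, DifferentiableAt ℝ (fun x : X => ‖x‖) (ε + (p v₁ - p w))}
  have hA : Dense A := dense_differentiableAt_norm_add _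
  have hq : Filter.Tendsto q (nhdsWithin 0 A) (nhds p) := by
    have hcont : Continuous q := continuous_const.update v₁ (continuous_id.add continuous_const)
    have h0 : q 0 = p := by simp [q]
    exact (h0 ▸ hcont.tendsto 0).mono_left nhdsWithin_le_nhds
  have hwell : ∀ ε ∈ A, IsWellPositioned G (q ε) := by
    intro ε hε v w hvw
    by_cases h₁ : v = v₁
    · subst h₁
      simpa [q, hvw.ne', add_sub_assoc] using hε w
    · by_cases h₂ : w = v₁
      · subst h₂
        have h := differentiableAt_norm_neg (hε v)
        rw [← add_sub_assoc, neg_sub] at h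
        simpa [q, h₁] using h
      · simpa [q, h₁, h₂] using hp v w hvw
  have : (nhdsWithin 0 A).NeBot := mem_closure_iff_nhdsWithin_neBot.1 (hA 0)
  obtain ⟨ε, hε, hεA⟩ := ((eventually_surjective_of_tendsto hp hsurj hq
    (Filter.eventually_of_mem self_mem_nhdsWithin hwell)).and self_mem_nhdsWithin).exists
  refine ⟨q ε, fun h => ?_, hwell ε hεA, hε⟩
  have h₂ := hεA v₂
  simp only [q, Function.update_self, Function.update_of_ne hv.symm] at h
  rw [← add_sub_assoc, h, sub_self] at h₂
  exact not_differentiableAt_norm_zero X h₂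

/-- A 0-extension `G'` of a graph `G` (adding a new vertex
joined to two distinct vertices `v₁, v₂` of `G`) is independent in a normed plane
`X` if and only if `G` is. -/
theorem zero_extension_independent_iff
    (X : Type*) [NormedAddCommGroup X] [NormedSpace ℝ X]
    (hdim : Module.finrank ℝ X = 2)
    (V : Type*) [Fintype V] (hV : 2 ≤ Fintype.card V)
    (G : SimpleGraph V) (v₁ v₂ : V) (hv : v₁ ≠ v₂)
    (G' : SimpleGraph (Option V))
    (hG' : ∀ a b : Option V, G'.Adj a b ↔
      ((∃ x y : V, a = some x ∧ b = some y ∧ G.Adj x y) ∨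
       (a = none ∧ (b = some v₁ ∨ b = some v₂)) ∨
       (b = none ∧ (a = some v₁ ∨ a = some v₂)))) :
    IsIndependentIn X G' ↔ IsIndependentIn X G := by
  have : FiniteDimensional ℝ X := Module.finite_of_finrank_pos (by omega)
  have : Nontrivial X := Module.nontrivial_of_finrank_pos (R := ℝ) (by omega)
  have hsome : ∀ {v w}, G.Adj v w → G'.Adj (some v) (some w) := fun h =>
    (hG' _ _).2 (Or.inl ⟨_, _, rfl, rfl, h⟩)
  constructor
  · rw [isIndependentIn_iff_sym2, isIndependentIn_iff_sym2]
    rintro ⟨p, hp, hsurj⟩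
    refine ⟨p ∘ some, fun v w h => hp _ _ (hsome h), fun m => ?_⟩
    obtain ⟨u, hu⟩ := hsurj
      fun e => m (e.map fun o => o.getD v₁)
    exact ⟨u ∘ some, fun v w h => hu _ _ (hsome h)⟩
  · intro hG
    obtain ⟨p, hne, hp, hsurj⟩ := exists_independent_placement_ne hG hv
    obtain ⟨x, hx, hxz, hfg⟩ := exists_fderiv_norm_ne hdim (sub_ne_zero.2 hne)
    rw [isIndependentIn_iff_sym2]
    let p' : Option V → X := fun o => o.elim (p v₁ + x) p
    have h₁ : p' none - p' (some v₁) = x := by simp [p']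
    have h₂ : p' none - p' (some v₂) = x + (p v₁ - p v₂) := by simp only [p', Option.elim]; abel
    have hwell : ∀ w, w = some v₁ ∨ w = some v₂ →
        DifferentiableAt ℝ (fun x : X => ‖x‖) (p' none - p' w) := by
      rintro w (rfl | rfl)
      · rwa [h₁]
      · rwa [h₂]
    refine ⟨p', fun v w h => ?_, fun m => ?_⟩
    · rcases (hG' v w).1 h with ⟨a, b, rfl, rfl, hab⟩ | ⟨rfl, hw⟩ | ⟨rfl, hw⟩
      · exact hp a b hab
      · exact hwell w hw
      · rw [← neg_sub]
        exact differentiableAt_norm_neg (hwell v hw)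
    · obtain ⟨u, hu⟩ := hsurj fun e => m (e.map some)
      have hg : fderiv ℝ (fun x : X => ‖x‖) (x + (p v₁ - p v₂)) ≠ 0 := by
        rw [← norm_ne_zero_iff, norm_fderiv_norm hxz]
        exact one_ne_zero
      obtain ⟨y, hy₁, hy₂⟩ := exists_apply_eq_of_forall_ne_smul hg hfg
        (m s(none, some v₁) + fderiv ℝ (fun x : X => ‖x‖) x (u v₁))
        (m s(none, some v₂) + fderiv ℝ (fun x : X => ‖x‖) (x + (p v₁ - p v₂)) (u v₂))
      let u' : Option V → X := fun o => o.elim y u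
      have hnew : ∀ w, w = some v₁ ∨ w = some v₂ →
          fderiv ℝ (fun x : X => ‖x‖) (p' none - p' w) (u' none - u' w) = m s(none, w) := by
        rintro w (rfl | rfl)
        · rw [h₁, map_sub]
          exact sub_eq_iff_eq_add.2 hy₁
        · rw [h₂, map_sub]
          exact sub_eq_iff_eq_add.2 hy₂
      refine ⟨u', fun v w h => ?_⟩
      rcases (hG' v w).1 h with ⟨a, b, rfl, rfl, hab⟩ | ⟨rfl, hw⟩ | ⟨rfl, hw⟩
      · exact hu a b hab
      · exact hnew w hw
      · rw [fderiv_norm_sub_comm, Sym2.eq_swap]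
        exact hnew v hw
end
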